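/- MAIN THEOREM. With the star-shaped quiver data fixed, the multiplicity (1/|GL_n(𝔽_q)|) · Σ_{h ∈ GL_n(𝔽_q)} Λ_m(h) · ∏_{i=1}^k R(γ_i)(h) equals the number of GL_α(𝔽_q)-orbits of representations x ∈ R(Q,α)(𝔽_q) such that every indecomposable direct summand Y of x ⊗ 𝔽̄_q has dimension vector belonging to H*_{σ,α}, i.e. dim Y is non-increasing along each leg and σ^{dim Y} = 1. -/

import Mathlib

open Matrix

namespace QRep

variable {I Ω : Type} (src tgt : Ω → I)

/-- A representation of the quiver with arrow set `Ω`, tail map `src`, head map `tgt`,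
of dimension vector `β`, over the field `K`: a matrix of size `β (tgt a) × β (src a)`
for every arrow `a`. -/
def Rep (K : Type) [Field K] (β : I → ℕ) : Type :=
  ∀ a : Ω, Matrix (Fin (β (tgt a))) (Fin (β (src a))) K

/-- Isomorphism of representations (of possibly different dimension vectors). -/
def RepIso {K : Type} [Field K] {β γ : I → ℕ} (x : Rep src tgt K β) (y : Rep src tgt K γ) :
    Prop :=
  ∃ e : ∀ i, (Fin (β i) → K) ≃ₗ[K] (Fin (γ i) → K),
    ∀ a : Ω, (Matrix.mulVecLin (y a)).comp (e (src a) : (Fin (β (src a)) → K) →ₗ[K] _)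
      = ((e (tgt a) : (Fin (β (tgt a)) → K) →ₗ[K] _)).comp (Matrix.mulVecLin (x a))

/-- Direct sum (block diagonal) of two representations. -/
def dsum {K : Type} [Field K] {β γ : I → ℕ} (x : Rep src tgt K β) (y : Rep src tgt K γ) :
    Rep src tgt K (β + γ) :=
  fun a => Matrix.reindex finSumFinEquiv finSumFinEquiv (Matrix.fromBlocks (x a) 0 0 (y a))

/-- A representation is indecomposable if its dimension vector is nonzero and it is not
isomorphic to a direct sum of two representations of nonzero dimension vectors. -/
def Indec {K : Type} [Field K] {β : I → ℕ} (x : Rep src tgt K β) : Prop :=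
  β ≠ 0 ∧ ∀ (β₁ β₂ : I → ℕ) (y : Rep src tgt K β₁) (z : Rep src tgt K β₂),
    β₁ ≠ 0 → β₂ ≠ 0 → ¬ RepIso src tgt x (dsum src tgt y z)

/-- Base change of a representation along a ring homomorphism of fields. -/
def baseChange {K L : Type} [Field K] [Field L] (f : K →+* L) {β : I → ℕ}
    (x : Rep src tgt K β) : Rep src tgt L β :=
  fun a => (x a).map f

/-- `x` is of level at most `V`: every indecomposable direct summand of
`x ⊗ K̄` has dimension vector belonging to `V`. -/
def LevelAtMost {K : Type} [Field K] {β : I → ℕ} (x : Rep src tgt K β)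
    (V : Set (I → ℕ)) : Prop :=
  ∀ (γ δ : I → ℕ) (Y : Rep src tgt (AlgebraicClosure K) γ)
    (z : Rep src tgt (AlgebraicClosure K) δ), Indec src tgt Y →
    RepIso src tgt (baseChange src tgt (algebraMap K (AlgebraicClosure K)) x)
      (dsum src tgt Y z) → γ ∈ V

/-- The action of `GL_β(K)` on representations of dimension vector `β`. -/
def glAct {K : Type} [Field K] {β : I → ℕ} (g : ∀ i, GL (Fin (β i)) K)
    (x : Rep src tgt K β) : Rep src tgt K β :=
  fun a => ((g (tgt a) : Matrix (Fin (β (tgt a))) (Fin (β (tgt a))) K) * x a) *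
    (((g (src a))⁻¹ : GL (Fin (β (src a))) K) : Matrix (Fin (β (src a))) (Fin (β (src a))) K)

/-- The number of `GL_β(K)`-orbits of representations of dimension vector `β`
satisfying the property `P`. -/
noncomputable def orbitCount {K : Type} [Field K] (β : I → ℕ)
    (P : Rep src tgt K β → Prop) : ℕ :=
  Nat.card (Quot fun x y : {x : Rep src tgt K β // P x} =>
    ∃ g : ∀ i, GL (Fin (β i)) K, glAct src tgt g x.1 = y.1)


open scoped Classical

/-- Apply a character `χ : 𝔽_q^× → ℂ^×` to a field element (0 outside the units). -/
noncomputable def χap {F : Type} [Field F] (χ : Fˣ →* ℂˣ) (d : F) : ℂ :=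
  if h : d = 0 then 0 else χ (Units.mk0 d h)

/-- The determinant of the endomorphism induced by `T` on the subquotient `W / (U ∩ W)`
(defined to be `0` if `T` does not preserve `W` and `U`). -/
noncomputable def quotDet {F M : Type} [Field F] [AddCommGroup M] [Module F M]
    (T : M →ₗ[F] M) (W U : Submodule F M) : F :=
  if h : (∀ x ∈ W, T x ∈ W) ∧ (∀ x ∈ U, T x ∈ U) then
    LinearMap.det (Submodule.mapQ (U.comap W.subtype) (U.comap W.subtype) (T.restrict h.1)
      (fun x hx => by
        simpa only [Submodule.mem_comap, LinearMap.restrict_apply, Submodule.subtype_apply]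
          using h.2 x.1 hx))
  else 0

/-- The Harish-Chandra induced character of the linear character `γ` of the Levi
`GL_{n_0} × ⋯ × GL_{n_l}` of `GL_n(𝔽_q)`, evaluated at `g`: the sum over all `g`-stable
flags `𝔽_q^n = V_0 ⊇ V_1 ⊇ ⋯` with `dim V_j = β j`, of `∏_{j=0}^{l} γ_j(det(ḡ_j))`,
where `ḡ_j` is the automorphism induced by `g` on `V_j / V_{j+1}`. -/
noncomputable def HC (F : Type) [Field F] (n l : ℕ) (β : ℕ → ℕ) (γ : ℕ → (Fˣ →* ℂˣ))
    (g : GL (Fin n) F) : ℂ :=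
  ∑ᶠ V : {V : ℕ → Submodule F (Fin n → F) //
      V 0 = ⊤ ∧ (∀ j, V (j + 1) ≤ V j) ∧ (∀ j, Module.finrank F (V j) = β j) ∧
      (∀ j, ∀ v ∈ V j, Matrix.mulVecLin (g : Matrix (Fin n) (Fin n) F) v ∈ V j)},
    ∏ j ∈ Finset.range (l + 1),
      χap (γ j) (quotDet (Matrix.mulVecLin (g : Matrix (Fin n) (Fin n) F))
        (V.1 j) (V.1 (j + 1)))

/-- The number of `m`-tuples of `n × n` matrices commuting with `g`; i.e. the character
of the conjugation action of `GL_n(𝔽_q)` on `𝔤𝔩_n(𝔽_q)^m`. -/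
noncomputable def Λcount (F : Type) [Field F] (n m : ℕ) (g : GL (Fin n) F) : ℕ :=
  Nat.card {A : Fin m → Matrix (Fin n) (Fin n) F //
    ∀ r, (g : Matrix (Fin n) (Fin n) F) * A r = A r * (g : Matrix (Fin n) (Fin n) F)}


/-- Vertices of the star-shaped quiver: `none` is the central vertex `0`, and
`some ⟨i, j⟩` is the vertex `[i, j+1]` on leg `i` (so `j : Fin (s i)` runs through the
leg vertices `[i,1], …, [i, s_i]`). -/
abbrev StarV (k : ℕ) (s : Fin k → ℕ) := Option ((i : Fin k) × Fin (s i))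

/-- Arrows of the star-shaped quiver: `m` loops at the central vertex together with, for
each leg `i` and each `j`, one arrow `[i, j+1] → [i, j]`. -/
abbrev StarA (k m : ℕ) (s : Fin k → ℕ) := Fin m ⊕ ((i : Fin k) × Fin (s i))

/-- The vertex `[i, j]` preceding `[i, j+1]` on a leg (the central vertex if `j = 0`). -/
def legPrev (k : ℕ) (s : Fin k → ℕ) (a : (i : Fin k) × Fin (s i)) : StarV k s :=
  if h : a.2.1 = 0 then none
  else some ⟨a.1, ⟨a.2.1 - 1, lt_of_le_of_lt (Nat.pred_le _) a.2.2⟩⟩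

/-- Tail map of the star-shaped quiver. -/
def starSrc (k m : ℕ) (s : Fin k → ℕ) : StarA k m s → StarV k s
  | .inl _ => none
  | .inr a => some a

/-- Head map of the star-shaped quiver. -/
def starTgt (k m : ℕ) (s : Fin k → ℕ) : StarA k m s → StarV k s
  | .inl _ => none
  | .inr a => legPrev k s a

/-- A dimension vector is non-increasing along each leg. -/
def NonIncr (k : ℕ) (s : Fin k → ℕ) (δ : StarV k s → ℕ) : Prop :=
  ∀ a : (i : Fin k) × Fin (s i), δ (some a) ≤ δ (legPrev k s a)

/-- `legβ k s nn i j = n_{i,j} + n_{i,j+1} + ⋯ + n_{i,s_i}`. -/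
def legβ (k : ℕ) (s : Fin k → ℕ) (nn : Fin k → ℕ → ℕ) (i : Fin k) (j : ℕ) : ℕ :=
  ∑ h ∈ Finset.Icc j (s i), nn i h

/-- The dimension vector `α`: `α_0 = n`, `α_{[i,j]} = n_{i,j} + ⋯ + n_{i,s_i}`. -/
def starα (k n : ℕ) (s : Fin k → ℕ) (nn : Fin k → ℕ → ℕ) : StarV k s → ℕ
  | none => n
  | some a => legβ k s nn a.1 (a.2.1 + 1)

/-- The tuple `σ`: `σ_0 = ∏_i γ_{i,0}` and `σ_{[i,j]} = γ_{i,j} γ_{i,j-1}^{-1}`. -/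
noncomputable def starσ (F : Type) [Field F] (k : ℕ) (s : Fin k → ℕ)
    (γ : Fin k → ℕ → (Fˣ →* ℂˣ)) : StarV k s → (Fˣ →* ℂˣ)
  | none => ∏ i, γ i 0
  | some a => γ a.1 (a.2.1 + 1) * (γ a.1 a.2.1)⁻¹


/-- The multiplicity `⟨Λ ⊗ R(γ_1) ⊗ ⋯ ⊗ R(γ_k), 1⟩ =
(1/|GL_n(𝔽_q)|) Σ_h Λ_m(h) ∏_i R(γ_i)(h)`. -/
noncomputable def mult (F : Type) [Field F] [Fintype F] (k m n : ℕ) (s : Fin k → ℕ)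
    (nn : Fin k → ℕ → ℕ) (γ : Fin k → ℕ → (Fˣ →* ℂˣ)) : ℂ :=
  (Nat.card (GL (Fin n) F) : ℂ)⁻¹ *
    ∑ᶠ h : GL (Fin n) F,
      (Λcount F n m h : ℂ) * ∏ i : Fin k, HC F n (s i) (legβ k s nn i) (γ i) h

end QRep

namespace QRep

open scoped Classical Pointwise

theorem exists_pow_isIdempotentElem {M : Type*} [Monoid M] [Finite M] (y : M) :
    ∃ N, 1 ≤ N ∧ IsIdempotentElem (y ^ N) := by
  obtain ⟨m, n, hmn, h⟩ : ∃ m n : ℕ, m < n ∧ y ^ m = y ^ n := by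
    obtain ⟨a, b, hab, h⟩ := Finite.exists_ne_map_eq_of_infinite (fun n : ℕ => y ^ n)
    rcases lt_or_gt_of_ne hab with h' | h'
    exacts [⟨a, b, h', h⟩, ⟨b, a, h', h.symm⟩]
  obtain ⟨d, rfl⟩ := Nat.exists_eq_add_of_lt hmn
  have step : ∀ k, m ≤ k → y ^ (k + (d + 1)) = y ^ k := by
    intro k hk
    obtain ⟨j, rfl⟩ := Nat.exists_eq_add_of_le hk
    rw [show m + j + (d + 1) = (m + d + 1) + j by ring, pow_add, ← h, ← pow_add]
  have steps : ∀ t k, m ≤ k → y ^ (k + t * (d + 1)) = y ^ k := by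
    intro t
    induction t with
    | zero => simp
    | succ t ih =>
      intro k hk
      rw [show k + (t + 1) * (d + 1) = (k + t * (d + 1)) + (d + 1) by ring,
        step _ (by omega), ih k hk]
  refine ⟨(m + 1) * (d + 1), Nat.one_le_iff_ne_zero.2 (by positivity), ?_⟩
  have : m ≤ (m + 1) * (d + 1) := by nlinarith
  rw [IsIdempotentElem, ← pow_add, steps _ _ this]

section Rank

variable {K : Type*} [Field K]

theorem rank_mul_of_mul_eq_one {n r : ℕ} {i : Matrix (Fin n) (Fin r) K}
    {p : Matrix (Fin r) (Fin n) K} (h : p * i = 1) : (i * p).rank = r := by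
  apply le_antisymm
  · exact (rank_mul_le_left i p).trans (by simpa using rank_le_width i)
  · have : (p * (i * p) * i).rank = r := by
      rw [Matrix.mul_assoc, Matrix.mul_assoc, h, Matrix.mul_one, h, rank_one, Fintype.card_fin]
    calc r = (p * (i * p) * i).rank := this.symm
      _ ≤ (p * (i * p)).rank := rank_mul_le_left _ _
      _ ≤ _ := rank_mul_le_right _ _

theorem exists_idempotent_factorization {n : ℕ} (e : Matrix (Fin n) (Fin n) K)
    (he : IsIdempotentElem e) :
    ∃ (i : Matrix (Fin n) (Fin e.rank) K) (p : Matrix (Fin e.rank) (Fin n) K),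
      i * p = e ∧ p * i = 1 := by
  let W := LinearMap.range e.mulVecLin
  have hr : Module.finrank K W = e.rank := rfl
  let b : Module.Basis (Fin e.rank) K W := Module.finBasisOfFinrankEq K W hr
  let I : (Fin e.rank → K) →ₗ[K] (Fin n → K) := W.subtype ∘ₗ b.equivFun.symm.toLinearMap
  let P : (Fin n → K) →ₗ[K] (Fin e.rank → K) := b.equivFun.toLinearMap ∘ₗ e.mulVecLin.rangeRestrict
  refine ⟨LinearMap.toMatrix' I, LinearMap.toMatrix' P, ?_, ?_⟩
  · rw [← LinearMap.toMatrix'_comp]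
    have : I ∘ₗ P = Matrix.toLin' e := by
      ext v : 2
      simp [I, P]
    rw [this, LinearMap.toMatrix'_toLin']
  · rw [← LinearMap.toMatrix'_comp]
    have : P ∘ₗ I = LinearMap.id := by
      apply LinearMap.ext
      intro v
      have : e.mulVecLin.rangeRestrict (b.equivFun.symm v : W) = b.equivFun.symm v := by
        apply Subtype.ext
        obtain ⟨w, hw⟩ := (b.equivFun.symm v).2
        rw [LinearMap.codRestrict_apply, ← hw]
        simp [Matrix.mulVec_mulVec, he.eq]
      change b.equivFun (e.mulVecLin.rangeRestrict (b.equivFun.symm v : W)) = v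
      rw [this, LinearEquiv.apply_symm_apply]
    rw [this, LinearMap.toMatrix'_id]

theorem rank_eq_of_mul_swap {m n : ℕ} {u : Matrix (Fin m) (Fin n) K} {w : Matrix (Fin n) (Fin m) K}
    (h1 : IsIdempotentElem (u * w)) (h2 : IsIdempotentElem (w * u)) :
    (u * w).rank = (w * u).rank := by
  apply le_antisymm
  · calc (u * w).rank = (u * (w * u) * w).rank := by
          rw [← h1.eq]; simp only [Matrix.mul_assoc]
      _ ≤ (u * (w * u)).rank := rank_mul_le_left _ _
      _ ≤ _ := rank_mul_le_right _ _
  · calc (w * u).rank = (w * (u * w) * u).rank := by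
          rw [← h2.eq]; simp only [Matrix.mul_assoc]
      _ ≤ (w * (u * w)).rank := rank_mul_le_left _ _
      _ ≤ _ := rank_mul_le_right _ _

theorem rank_map_idempotent {L : Type*} [Field L] (f : K →+* L) {n : ℕ}
    (e : Matrix (Fin n) (Fin n) K) (he : IsIdempotentElem e) : (e.map f).rank = e.rank := by
  obtain ⟨i, p, h1, h2⟩ := exists_idempotent_factorization e he
  have h3 : p.map f * i.map f = 1 := by
    rw [← Matrix.map_mul, h2, Matrix.map_one _ (map_zero f) (map_one f)]
  have := rank_mul_of_mul_eq_one h3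
  rwa [← Matrix.map_mul, h1] at this

theorem det_one_add_smul_idempotent {n : ℕ} (e : Matrix (Fin n) (Fin n) K)
    (he : IsIdempotentElem e) (t : K) : (1 + (t - 1) • e).det = t ^ e.rank := by
  obtain ⟨i, p, h1, h2⟩ := exists_idempotent_factorization e he
  rw [show (t - 1) • e = i * ((t - 1) • p) by rw [Matrix.mul_smul, h1],
    Matrix.det_one_add_mul_comm, Matrix.smul_mul, h2]
  rw [show (1 : Matrix (Fin e.rank) (Fin e.rank) K) + (t - 1) • 1 = t • 1 by
    rw [sub_smul, one_smul]; abel]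
  rw [det_smul, det_one, Fintype.card_fin, mul_one]

theorem rank_add_idempotent {n : ℕ} (e f : Matrix (Fin n) (Fin n) K)
    (he : IsIdempotentElem e) (hf : IsIdempotentElem f) (h1 : e * f = 0) (h2 : f * e = 0) :
    (e + f).rank = e.rank + f.rank := by
  obtain ⟨i, p, h3, h4⟩ := exists_idempotent_factorization e he
  obtain ⟨j, q, h5, h6⟩ := exists_idempotent_factorization f hf
  have hpj : p * j = 0 := by
    calc p * j = (p * i) * p * (j * (q * j)) := by rw [h4, h6]; simp
      _ = p * ((i * p) * (j * q)) * j := by simp only [Matrix.mul_assoc]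
      _ = 0 := by rw [h3, h5, h1]; simp
  have hqi : q * i = 0 := by
    calc q * i = (q * j) * q * (i * (p * i)) := by rw [h4, h6]; simp
      _ = q * ((j * q) * (i * p)) * i := by simp only [Matrix.mul_assoc]
      _ = 0 := by rw [h3, h5, h2]; simp
  let I := (Matrix.fromCols i j).reindex (Equiv.refl _) finSumFinEquiv
  let P := (Matrix.fromRows p q).reindex finSumFinEquiv (Equiv.refl _)
  have hIP : I * P = e + f := by
    simp only [I, P, reindex_apply]
    rw [Matrix.submatrix_mul_equiv, Matrix.fromCols_mul_fromRows, h3, h5]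
    rfl
  have hPI : P * I = 1 := by
    simp only [I, P, reindex_apply]
    have : (p.fromRows q).submatrix finSumFinEquiv.symm (Equiv.refl (Fin n)).symm *
      (i.fromCols j).submatrix (Equiv.refl (Fin n)).symm finSumFinEquiv.symm
        = ((p.fromRows q) * (i.fromCols j)).submatrix finSumFinEquiv.symm finSumFinEquiv.symm :=
      Matrix.submatrix_mul_equiv _ _ _ _ _
    rw [this, Matrix.fromRows_mul_fromCols, h4, h6, hpj, hqi, fromBlocks_one, submatrix_one_equiv]
  rw [← hIP]
  exact rank_mul_of_mul_eq_one hPI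

theorem rank_le_of_isNilpotent_sub {n : ℕ} (e f : Matrix (Fin n) (Fin n) K)
    (hf : IsIdempotentElem f) (h : IsNilpotent (f * (f - e) * f)) : f.rank ≤ e.rank := by
  obtain ⟨N, hN⟩ := h
  set y := f * (f - e) * f with hy
  have hfy : f * y = y := by rw [hy, ← mul_assoc, ← mul_assoc, hf.eq]
  have h1 : f * (1 - y) = f * e * f := by
    rw [mul_sub, hfy, hy, mul_sub, sub_mul, hf.eq, hf.eq]; simp
  have h2 : f * e * f * (∑ i ∈ Finset.range N, y ^ i) = f := by
    rw [← h1, mul_assoc, mul_neg_geom_sum, hN, sub_zero, mul_one]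
  calc f.rank = (f * e * f * (∑ i ∈ Finset.range N, y ^ i)).rank := by rw [h2]
    _ ≤ (f * e * f).rank := rank_mul_le_left _ _
    _ ≤ (f * e).rank := rank_mul_le_left _ _
    _ ≤ _ := rank_mul_le_right _ _

end Rank

section Lagrange

variable {K R : Type*} [Field K] [Ring R] [Algebra K R]

/-- The spectral projection of `a` at `l`, where `S` is a finite set containing the
eigenvalues of the semisimple element `a`. -/
noncomputable def specProj (a : R) (S : Finset K) (l : K) : R :=
  Polynomial.aeval a (Lagrange.basis S id l)

theorem aeval_eq_sum_specProj {a : R} {S : Finset K}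
    (h : Polynomial.aeval a (∏ l ∈ S, (Polynomial.X - Polynomial.C l)) = 0)
    (p : Polynomial K) :
    Polynomial.aeval a p = ∑ l ∈ S, p.eval l • specProj a S l := by
  have hd : (∏ l ∈ S, (Polynomial.X - Polynomial.C l)) ∣
      p - Lagrange.interpolate S id (fun l => p.eval l) := by
    apply Finset.prod_dvd_of_coprime
    · intro l _ m _ hlm
      exact Polynomial.isCoprime_X_sub_C_of_isUnit_sub (sub_ne_zero.2 hlm).isUnit
    · intro l hl
      rw [Polynomial.dvd_iff_isRoot, Polynomial.IsRoot, Polynomial.eval_sub]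
      have := Lagrange.eval_interpolate_at_node (fun l => p.eval l)
        (Function.injective_id.injOn (s := (S : Set K))) hl
      simp only [id] at this
      rw [this, sub_self]
  obtain ⟨c, hc⟩ := hd
  have h2 := congrArg (Polynomial.aeval a) hc
  rw [map_sub, map_mul, h, zero_mul, sub_eq_zero] at h2
  rw [h2, Lagrange.interpolate_apply, map_sum]
  refine Finset.sum_congr rfl fun l _ => ?_
  rw [map_mul, Polynomial.aeval_C, Algebra.smul_def]; rfl

theorem specProj_mul {a : R} {S : Finset K}
    (h : Polynomial.aeval a (∏ l ∈ S, (Polynomial.X - Polynomial.C l)) = 0) {l m : K}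
    (hl : l ∈ S) (hm : m ∈ S) :
    specProj a S l * specProj a S m = if l = m then specProj a S l else 0 := by
  have key : ∀ l ∈ S, ∀ m ∈ S, (Lagrange.basis S id l).eval m = if l = m then 1 else 0 := by
    intro l hl m hm
    split_ifs with hlm
    · subst hlm
      exact Lagrange.eval_basis_self (v := id) Function.injective_id.injOn hl
    · exact Lagrange.eval_basis_of_ne (v := id) hlm hm
  unfold specProj
  rw [← map_mul, aeval_eq_sum_specProj h]
  have : ∀ k ∈ S, (Lagrange.basis S id l * Lagrange.basis S id m).eval k • specProj a S k
      = if k = l then (if l = m then specProj a S l else 0) else 0 := by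
    intro k hk
    rw [Polynomial.eval_mul, key l hl k hk, key m hm k hk]
    by_cases h1 : l = k
    · subst h1
      by_cases h2 : m = l
      · subst h2; simp
      · simp [h2, Ne.symm h2]
    · simp [h1, Ne.symm h1]
  rw [Finset.sum_congr rfl this, Finset.sum_ite_eq' S l, if_pos hl]
  rfl

theorem sum_specProj {a : R} {S : Finset K}
    (h : Polynomial.aeval a (∏ l ∈ S, (Polynomial.X - Polynomial.C l)) = 0) :
    ∑ l ∈ S, specProj a S l = 1 := by
  have := aeval_eq_sum_specProj h 1
  simpa using this.symm

theorem mul_specProj {a : R} {S : Finset K}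
    (h : Polynomial.aeval a (∏ l ∈ S, (Polynomial.X - Polynomial.C l)) = 0)
    (p : Polynomial K) {m : K} (hm : m ∈ S) :
    Polynomial.aeval a p * specProj a S m = p.eval m • specProj a S m := by
  rw [aeval_eq_sum_specProj h, Finset.sum_mul]
  have : ∀ k ∈ S, (p.eval k • specProj a S k) * specProj a S m
      = if k = m then p.eval m • specProj a S m else 0 := by
    intro k hk
    rw [smul_mul_assoc, specProj_mul h hk hm]
    split_ifs with h1
    · rw [h1]
    · simp
  rw [Finset.sum_congr rfl this, Finset.sum_ite_eq' S m, if_pos hm]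

end Lagrange

section Tuples

variable {I : Type}

/-- Tuples of square matrices indexed by the vertices. -/
abbrev Tup (K : Type*) [Field K] (β : I → ℕ) : Type _ :=
  ∀ v, Matrix (Fin (β v)) (Fin (β v)) K

/-- Entrywise application of a ring homomorphism to a tuple of square matrices. -/
def mapTup {K L : Type*} [Field K] [Field L] (f : K →+* L) (β : I → ℕ) :
    Tup K β →+* Tup L β :=
  RingHom.pi fun v => f.mapMatrix.comp (Pi.evalRingHom _ v)

theorem mapTup_apply {K L : Type*} [Field K] [Field L] (f : K →+* L) (β : I → ℕ)
    (g : Tup K β) (v : I) : mapTup f β g v = (g v).map f := rfl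

theorem mapTup_smul {K L : Type*} [Field K] [Field L] (f : K →+* L) (β : I → ℕ)
    (c : K) (g : Tup K β) : mapTup f β (c • g) = f c • mapTup f β g := by
  funext v
  ext i j
  simp [mapTup_apply]

/-- The vector of ranks of a tuple of matrices. -/
noncomputable def rk {K : Type*} [Field K] {β : I → ℕ} (e : Tup K β) : I → ℕ :=
  fun v => (e v).rank

theorem idem_apply {K : Type*} [Field K] {β : I → ℕ} {e : Tup K β} (he : IsIdempotentElem e)
    (v : I) : IsIdempotentElem (e v) := congrFun he v

theorem rk_eq_zero {K : Type*} [Field K] {β : I → ℕ} {e : Tup K β} (he : IsIdempotentElem e) :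
    rk e = 0 ↔ e = 0 := by
  constructor
  · intro h
    funext v
    have : (e v).rank = 0 := congrFun h v
    obtain ⟨i, p, h1, -⟩ := exists_idempotent_factorization (e v) (idem_apply he v)
    rw [← h1]
    ext a b
    rw [Matrix.mul_apply]
    exact Finset.sum_eq_zero fun k _ => absurd k.2 (by omega)
  · rintro rfl
    funext v
    simp [rk]

theorem rk_add {K : Type*} [Field K] {β : I → ℕ} {e f : Tup K β} (he : IsIdempotentElem e)
    (hf : IsIdempotentElem f) (h1 : e * f = 0) (h2 : f * e = 0) : rk (e + f) = rk e + rk f := by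
  funext v
  exact rank_add_idempotent _ _ (idem_apply he v) (idem_apply hf v) (congrFun h1 v) (congrFun h2 v)

theorem rk_sum {K ι : Type*} [Field K] {β : I → ℕ} (S : Finset ι) (e : ι → Tup K β)
    (h : ∀ i ∈ S, ∀ j ∈ S, e i * e j = if i = j then e i else 0) :
    rk (∑ i ∈ S, e i) = ∑ i ∈ S, rk (e i) := by
  induction S using Finset.induction_on with
  | empty => simpa using (rk_eq_zero (K := K) (β := β) IsIdempotentElem.zero).2 rfl
  | insert a S ha ih =>
    have hS : ∀ i ∈ S, ∀ j ∈ S, e i * e j = if i = j then e i else 0 := fun i hi j hj =>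
      h i (Finset.mem_insert_of_mem hi) j (Finset.mem_insert_of_mem hj)
    rw [Finset.sum_insert ha, Finset.sum_insert ha, ← ih hS]
    have hne : ∀ j ∈ S, a ≠ j := fun j hj haj => ha (haj ▸ hj)
    apply rk_add
    · exact (h a (Finset.mem_insert_self _ _) a (Finset.mem_insert_self _ _)).trans (if_pos rfl)
    · rw [IsIdempotentElem, Finset.sum_mul_sum]
      refine Finset.sum_congr rfl fun i hi => ?_
      rw [Finset.sum_congr rfl (fun j hj => hS i hi j hj), Finset.sum_ite_eq, if_pos hi]
    · rw [Finset.mul_sum]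
      refine Finset.sum_eq_zero fun j hj => ?_
      rw [h a (Finset.mem_insert_self _ _) j (Finset.mem_insert_of_mem hj), if_neg (hne j hj)]
    · rw [Finset.sum_mul]
      refine Finset.sum_eq_zero fun j hj => ?_
      rw [h j (Finset.mem_insert_of_mem hj) a (Finset.mem_insert_self _ _),
        if_neg (hne j hj).symm]

theorem rk_mapTup {K L : Type*} [Field K] [Field L] (f : K →+* L) {β : I → ℕ} {e : Tup K β}
    (he : IsIdempotentElem e) : rk (mapTup f β e) = rk e := by
  funext v
  exact rank_map_idempotent f _ (idem_apply he v)

/-- Primitive idempotents of a subalgebra. -/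
structure IsPrim {K : Type*} [Field K] {β : I → ℕ} (A : Subalgebra K (Tup K β))
    (e : Tup K β) : Prop where
  mem : e ∈ A
  idem : IsIdempotentElem e
  ne_zero : e ≠ 0
  eq_of_le : ∀ f ∈ A, IsIdempotentElem f → e * f = f → f * e = f → f = 0 ∨ f = e

theorem rk_mem_of_prim [Fintype I] {K : Type*} [Field K] {β : I → ℕ}
    (A : Subalgebra K (Tup K β)) (S : AddSubmonoid (I → ℕ))
    (hS : ∀ e, IsPrim A e → rk e ∈ S) (e : Tup K β) (heA : e ∈ A) (he : IsIdempotentElem e) :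
    rk e ∈ S := by
  induction hN : ∑ v, rk e v using Nat.strong_induction_on generalizing e with
  | _ N ih =>
    by_cases h0 : e = 0
    · rw [(rk_eq_zero he).2 h0]; exact S.zero_mem
    by_cases hp : IsPrim A e
    · exact hS e hp
    obtain ⟨f, hfA, hf, h1, h2, hf0, hfe⟩ : ∃ f ∈ A, IsIdempotentElem f ∧ e * f = f ∧ f * e = f ∧
        f ≠ 0 ∧ f ≠ e := by
      by_contra! hcon
      refine hp ⟨heA, he, h0, fun f hfA hf h1 h2 => ?_⟩
      by_contra! hne
      exact hne.2 (hcon f hfA hf h1 h2 hne.1)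
    have hg : IsIdempotentElem (e - f) := by
      rw [IsIdempotentElem, mul_sub, sub_mul, sub_mul, he.eq, hf.eq, h1, h2]; abel
    have hfg : f * (e - f) = 0 := by rw [mul_sub, h2, hf.eq, sub_self]
    have hgf : (e - f) * f = 0 := by rw [sub_mul, h1, hf.eq, sub_self]
    have hadd : rk e = rk f + rk (e - f) := by
      rw [← rk_add hf hg hfg hgf, add_sub_cancel]
    have hpos : ∀ g : Tup K β, IsIdempotentElem g → g ≠ 0 → 0 < ∑ v, rk g v := by
      intro g hg hg0
      rw [pos_iff_ne_zero]
      intro hz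
      rw [Finset.sum_eq_zero_iff] at hz
      exact hg0 ((rk_eq_zero hg).1 (funext fun v => hz v (Finset.mem_univ v)))
    have hsum : ∑ v, rk e v = ∑ v, rk f v + ∑ v, rk (e - f) v := by
      rw [hadd, ← Finset.sum_add_distrib]; rfl
    have p1 := hpos f hf hf0
    have p2 := hpos (e - f) hg (sub_ne_zero.2 (Ne.symm hfe))
    rw [hadd]
    exact S.add_mem (ih _ (by omega) f hfA hf rfl) (ih _ (by omega) _ (A.sub_mem heA hfA) hg rfl)

end Tuples

section Hom

variable {I Ω : Type} {src tgt : Ω → I} {K : Type} [Field K]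

variable (src tgt) in
/-- Homomorphisms of representations, as tuples of matrices. -/
def IsHom {β γ : I → ℕ} (x : Rep src tgt K β) (y : Rep src tgt K γ)
    (u : ∀ v, Matrix (Fin (γ v)) (Fin (β v)) K) : Prop :=
  ∀ a, u (tgt a) * x a = y a * u (src a)

theorem IsHom.comp {β γ δ : I → ℕ} {x : Rep src tgt K β} {y : Rep src tgt K γ}
    {z : Rep src tgt K δ} {u : ∀ v, Matrix (Fin (γ v)) (Fin (β v)) K}
    {w : ∀ v, Matrix (Fin (δ v)) (Fin (γ v)) K} (hw : IsHom src tgt y z w)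
    (hu : IsHom src tgt x y u) : IsHom src tgt x z (fun v => w v * u v) := by
  intro a
  rw [Matrix.mul_assoc, hu a, ← Matrix.mul_assoc, hw a, Matrix.mul_assoc]

variable (src tgt) in
/-- The endomorphism algebra of a representation. -/
def endAlg {β : I → ℕ} (x : Rep src tgt K β) : Subalgebra K (Tup K β) where
  carrier := {g | IsHom src tgt x x g}
  mul_mem' {g h} hg hh := hg.comp hh
  add_mem' {g h} hg hh a := by
    simp only [Pi.add_apply, Matrix.add_mul, Matrix.mul_add, hg a, hh a]
  algebraMap_mem' c a := by
    simp only [Algebra.algebraMap_eq_smul_one, Pi.smul_apply, Pi.one_apply, Matrix.smul_mul,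
      Matrix.mul_smul, Matrix.one_mul, Matrix.mul_one]

theorem mem_endAlg {β : I → ℕ} {x : Rep src tgt K β} {g : Tup K β} :
    g ∈ endAlg src tgt x ↔ IsHom src tgt x x g := Iff.rfl

theorem repIso_iff {β γ : I → ℕ} {x : Rep src tgt K β} {y : Rep src tgt K γ} :
    RepIso src tgt x y ↔ ∃ (u : ∀ v, Matrix (Fin (γ v)) (Fin (β v)) K)
      (w : ∀ v, Matrix (Fin (β v)) (Fin (γ v)) K), IsHom src tgt x y u ∧
      (∀ v, u v * w v = 1) ∧ ∀ v, w v * u v = 1 := by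
  constructor
  · rintro ⟨e, he⟩
    refine ⟨fun v => LinearMap.toMatrix' (e v).toLinearMap,
      fun v => LinearMap.toMatrix' (e v).symm.toLinearMap, fun a => ?_, fun v => ?_, fun v => ?_⟩
    · have := congrArg LinearMap.toMatrix' (he a)
      rw [LinearMap.toMatrix'_comp, LinearMap.toMatrix'_comp, ← Matrix.toLin'_apply',
        ← Matrix.toLin'_apply', LinearMap.toMatrix'_toLin', LinearMap.toMatrix'_toLin'] at this
      exact this.symm
    · rw [← LinearMap.toMatrix'_comp, LinearEquiv.comp_symm, LinearMap.toMatrix'_id]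
    · rw [← LinearMap.toMatrix'_comp, LinearEquiv.symm_comp, LinearMap.toMatrix'_id]
  · rintro ⟨u, w, hu, h1, h2⟩
    refine ⟨fun v => Matrix.toLin'OfInv (h2 v) (h1 v), fun a => ?_⟩
    apply LinearMap.ext
    intro t
    change (y a).mulVec ((u (src a)).mulVec t) = (u (tgt a)).mulVec ((x a).mulVec t)
    rw [Matrix.mulVec_mulVec, Matrix.mulVec_mulVec, hu a]

theorem isHom_inv {β γ : I → ℕ} {x : Rep src tgt K β} {y : Rep src tgt K γ}
    {u : ∀ v, Matrix (Fin (γ v)) (Fin (β v)) K} {w : ∀ v, Matrix (Fin (β v)) (Fin (γ v)) K}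
    (hu : IsHom src tgt x y u) (h1 : ∀ v, u v * w v = 1) (h2 : ∀ v, w v * u v = 1) :
    IsHom src tgt y x w := by
  intro a
  calc w (tgt a) * y a = w (tgt a) * (y a * (u (src a) * w (src a))) := by
        rw [h1, Matrix.mul_one]
    _ = w (tgt a) * (u (tgt a) * x a) * w (src a) := by
        rw [hu a]; simp only [Matrix.mul_assoc]
    _ = (w (tgt a) * u (tgt a)) * x a * w (src a) := by simp only [Matrix.mul_assoc]
    _ = _ := by rw [h2, Matrix.one_mul]

theorem inclusion_mul_block {a b c d : ℕ} (Y : Matrix (Fin a) (Fin c) K)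
    (Z : Matrix (Fin b) (Fin d) K) :
    ((Matrix.fromRows 1 0).submatrix finSumFinEquiv.symm id : Matrix (Fin (a + b)) (Fin a) K) * Y
      = ((Matrix.fromBlocks Y 0 0 Z).submatrix finSumFinEquiv.symm finSumFinEquiv.symm :
          Matrix (Fin (a + b)) (Fin (c + d)) K) *
        ((Matrix.fromRows 1 0).submatrix finSumFinEquiv.symm id :
          Matrix (Fin (c + d)) (Fin c) K) := by
  ext i j
  refine Fin.addCases (fun i => ?_) (fun i => ?_) i <;>
    simp [Matrix.mul_apply, Fin.sum_univ_add, Matrix.one_apply]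

theorem projection_mul_block {a b c d : ℕ} (Y : Matrix (Fin a) (Fin c) K)
    (Z : Matrix (Fin b) (Fin d) K) :
    ((Matrix.fromCols 1 0).submatrix id finSumFinEquiv.symm : Matrix (Fin a) (Fin (a + b)) K) *
        ((Matrix.fromBlocks Y 0 0 Z).submatrix finSumFinEquiv.symm finSumFinEquiv.symm :
          Matrix (Fin (a + b)) (Fin (c + d)) K)
      = Y * ((Matrix.fromCols 1 0).submatrix id finSumFinEquiv.symm :
          Matrix (Fin c) (Fin (c + d)) K) := by
  ext i j
  refine Fin.addCases (fun j => ?_) (fun j => ?_) j <;>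
    simp [Matrix.mul_apply, Fin.sum_univ_add, Matrix.one_apply]

theorem projection_mul_inclusion (a b : ℕ) :
    ((Matrix.fromCols 1 0).submatrix id finSumFinEquiv.symm : Matrix (Fin a) (Fin (a + b)) K) *
      ((Matrix.fromRows 1 0).submatrix finSumFinEquiv.symm id : Matrix (Fin (a + b)) (Fin a) K)
      = 1 ∧
    ((Matrix.fromCols 0 1).submatrix id finSumFinEquiv.symm : Matrix (Fin b) (Fin (a + b)) K) *
      ((Matrix.fromRows 0 1).submatrix finSumFinEquiv.symm id : Matrix (Fin (a + b)) (Fin b) K)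
      = 1 ∧
    ((Matrix.fromCols 0 1).submatrix id finSumFinEquiv.symm : Matrix (Fin b) (Fin (a + b)) K) *
      ((Matrix.fromRows 1 0).submatrix finSumFinEquiv.symm id : Matrix (Fin (a + b)) (Fin a) K)
      = 0 := by
  refine ⟨?_, ?_, ?_⟩ <;> rw [Matrix.submatrix_mul_equiv, Matrix.fromCols_mul_fromRows] <;> simp

theorem dsum_inclusions {β γ : I → ℕ} (y : Rep src tgt K β) (z : Rep src tgt K γ) :
    ∃ (i : ∀ v, Matrix (Fin ((β + γ) v)) (Fin (β v)) K)
      (p : ∀ v, Matrix (Fin (β v)) (Fin ((β + γ) v)) K)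
      (j : ∀ v, Matrix (Fin ((β + γ) v)) (Fin (γ v)) K)
      (q : ∀ v, Matrix (Fin (γ v)) (Fin ((β + γ) v)) K),
      IsHom src tgt y (dsum src tgt y z) i ∧ IsHom src tgt (dsum src tgt y z) y p ∧
      (∀ v, p v * i v = 1) ∧ (∀ v, q v * j v = 1) ∧ (∀ v, q v * i v = 0) := by
  refine ⟨fun v => (Matrix.fromRows 1 0).submatrix finSumFinEquiv.symm id,
    fun v => (Matrix.fromCols 1 0).submatrix id finSumFinEquiv.symm,
    fun v => (Matrix.fromRows 0 1).submatrix finSumFinEquiv.symm id,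
    fun v => (Matrix.fromCols 0 1).submatrix id finSumFinEquiv.symm,
    fun a => ?_, fun a => ?_, fun v => ?_, fun v => ?_, fun v => ?_⟩
  · exact inclusion_mul_block _ _
  · exact projection_mul_block _ _
  · exact (projection_mul_inclusion _ _).1
  · exact (projection_mul_inclusion _ _).2.1
  · exact (projection_mul_inclusion _ _).2.2

theorem compress_mul {a b c d : ℕ} {X : Matrix (Fin a) (Fin b) K}
    {i₁ : Matrix (Fin a) (Fin c) K} {p₁ : Matrix (Fin c) (Fin a) K}
    {i₂ : Matrix (Fin b) (Fin d) K} {p₂ : Matrix (Fin d) (Fin b) K}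
    (h : i₁ * p₁ * X = X * (i₂ * p₂)) (h₁ : p₁ * i₁ = 1) (h₂ : p₂ * i₂ = 1) :
    i₁ * (p₁ * X * i₂) = X * i₂ ∧ p₁ * X = p₁ * X * i₂ * p₂ := by
  constructor
  · calc i₁ * (p₁ * X * i₂) = i₁ * p₁ * X * i₂ := by simp only [Matrix.mul_assoc]
      _ = X * i₂ := by rw [h, Matrix.mul_assoc, Matrix.mul_assoc, h₂, Matrix.mul_one]
  · calc p₁ * X = p₁ * (i₁ * p₁ * X) := by
          rw [Matrix.mul_assoc, ← Matrix.mul_assoc, h₁, Matrix.one_mul]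
      _ = _ := by rw [h]; simp only [Matrix.mul_assoc]

/-- The splitting of a representation along an idempotent endomorphism. -/
theorem exists_image {β : I → ℕ} {x : Rep src tgt K β} {e : Tup K β}
    (he : e ∈ endAlg src tgt x) (hi : IsIdempotentElem e) :
    ∃ (y : Rep src tgt K (rk e)) (i : ∀ v, Matrix (Fin (β v)) (Fin (rk e v)) K)
      (p : ∀ v, Matrix (Fin (rk e v)) (Fin (β v)) K),
      IsHom src tgt y x i ∧ IsHom src tgt x y p ∧ (∀ v, i v * p v = e v) ∧
      ∀ v, p v * i v = 1 := by
  choose i p h1 h2 using fun v => exists_idempotent_factorization (e v) (idem_apply hi v)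
  have key : ∀ a, i (tgt a) * p (tgt a) * x a = x a * (i (src a) * p (src a)) := fun a =>
    (congrArg (· * x a) (h1 (tgt a))).trans ((he a).trans (congrArg (x a * ·) (h1 (src a))).symm)
  exact ⟨fun a => p (tgt a) * x a * i (src a), i, p,
    fun a => (compress_mul (key a) (h2 _) (h2 _)).1,
    fun a => (compress_mul (key a) (h2 _) (h2 _)).2, h1, h2⟩

theorem rows_mul_block {a b c d n m : ℕ} (X : Matrix (Fin n) (Fin m) K)
    (Y : Matrix (Fin a) (Fin c) K) (Z : Matrix (Fin b) (Fin d) K)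
    (p : Matrix (Fin a) (Fin n) K) (q : Matrix (Fin b) (Fin n) K)
    (p' : Matrix (Fin c) (Fin m) K) (q' : Matrix (Fin d) (Fin m) K)
    (hp : p * X = Y * p') (hq : q * X = Z * q') :
    ((Matrix.fromRows p q).submatrix finSumFinEquiv.symm id : Matrix (Fin (a + b)) (Fin n) K) * X
      = ((Matrix.fromBlocks Y 0 0 Z).submatrix finSumFinEquiv.symm finSumFinEquiv.symm :
          Matrix (Fin (a + b)) (Fin (c + d)) K) *
        ((Matrix.fromRows p' q').submatrix finSumFinEquiv.symm id :
          Matrix (Fin (c + d)) (Fin m) K) := by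
  ext i j
  refine Fin.addCases (fun i => ?_) (fun i => ?_) i
  · have := congrFun (congrFun hp i) j
    simpa [Matrix.mul_apply, Fin.sum_univ_add] using this
  · have := congrFun (congrFun hq i) j
    simpa [Matrix.mul_apply, Fin.sum_univ_add] using this

theorem rows_mul_cols {a b n : ℕ} (p : Matrix (Fin a) (Fin n) K) (q : Matrix (Fin b) (Fin n) K)
    (i : Matrix (Fin n) (Fin a) K) (j : Matrix (Fin n) (Fin b) K)
    (h1 : p * i = 1) (h2 : q * j = 1) (h3 : p * j = 0) (h4 : q * i = 0)
    (h5 : i * p + j * q = 1) :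
    ((Matrix.fromRows p q).submatrix finSumFinEquiv.symm id : Matrix (Fin (a + b)) (Fin n) K) *
      ((Matrix.fromCols i j).submatrix id finSumFinEquiv.symm : Matrix (Fin n) (Fin (a + b)) K)
      = 1 ∧
    ((Matrix.fromCols i j).submatrix id finSumFinEquiv.symm : Matrix (Fin n) (Fin (a + b)) K) *
      ((Matrix.fromRows p q).submatrix finSumFinEquiv.symm id : Matrix (Fin (a + b)) (Fin n) K)
      = 1 := by
  constructor
  · have : ∀ (f : Fin (a + b) ≃ Fin a ⊕ Fin b), (Matrix.fromRows p q).submatrix f id *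
      (Matrix.fromCols i j).submatrix id f = ((p.fromRows q) * (i.fromCols j)).submatrix f f :=
      fun f => rfl
    rw [this, Matrix.fromRows_mul_fromCols, h1, h2, h3, h4, fromBlocks_one, submatrix_one_equiv]
  · rw [Matrix.submatrix_mul_equiv, Matrix.fromCols_mul_fromRows, h5]
    rfl

theorem exists_dsum {β : I → ℕ} {x : Rep src tgt K β} {e : Tup K β}
    (he : e ∈ endAlg src tgt x) (hi : IsIdempotentElem e) :
    ∃ (y : Rep src tgt K (rk e)) (z : Rep src tgt K (rk (1 - e)))
      (i : ∀ v, Matrix (Fin (β v)) (Fin (rk e v)) K)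
      (p : ∀ v, Matrix (Fin (rk e v)) (Fin (β v)) K),
      IsHom src tgt y x i ∧ IsHom src tgt x y p ∧ (∀ v, i v * p v = e v) ∧
      (∀ v, p v * i v = 1) ∧ RepIso src tgt x (dsum src tgt y z) := by
  obtain ⟨y, i, p, hi1, hp, h1, h2⟩ := exists_image he hi
  have hi' : IsIdempotentElem (1 - e) := hi.one_sub
  obtain ⟨z, j, q, hj, hq, h3, h4⟩ := exists_image (Subalgebra.sub_mem _ (one_mem _) he) hi'
  refine ⟨y, z, i, p, hi1, hp, h1, h2, repIso_iff.2 ?_⟩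
  have h3' : ∀ v, j v * q v = 1 - e v := h3
  have key : ∀ v, p v * j v = 0 ∧ q v * i v = 0 := by
    intro v
    have he2 : e v * e v = e v := idem_apply hi v
    constructor
    · calc p v * j v = (p v * i v) * p v * (j v * (q v * j v)) := by
            rw [h2, h4, Matrix.one_mul, Matrix.mul_one]
        _ = p v * ((i v * p v) * (j v * q v)) * j v := by simp only [Matrix.mul_assoc]
        _ = 0 := by rw [h1, h3', mul_sub, he2, mul_one, sub_self]; simp
    · calc q v * i v = (q v * j v) * q v * (i v * (p v * i v)) := by
            rw [h2, h4, Matrix.one_mul, Matrix.mul_one]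
        _ = q v * ((j v * q v) * (i v * p v)) * i v := by simp only [Matrix.mul_assoc]
        _ = 0 := by rw [h1, h3', sub_mul, he2, one_mul, sub_self]; simp
  have hboth : ∀ v, _ ∧ _ := fun v => rows_mul_cols (p v) (q v) (i v) (j v) (h2 v) (h4 v)
    (key v).1 (key v).2 (by rw [h1, h3', add_sub_cancel])
  exact ⟨fun v => (Matrix.fromRows (p v) (q v)).submatrix finSumFinEquiv.symm id,
    fun v => (Matrix.fromCols (i v) (j v)).submatrix id finSumFinEquiv.symm,
    fun a => rows_mul_block _ _ _ _ _ _ _ (hp a) (hq a), fun v => (hboth v).1,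
    fun v => (hboth v).2⟩

theorem idempotent_eq_of_indec {β : I → ℕ} {x : Rep src tgt K β} (hx : Indec src tgt x)
    {e : Tup K β} (he : e ∈ endAlg src tgt x) (hi : IsIdempotentElem e) : e = 0 ∨ e = 1 := by
  by_contra! h
  obtain ⟨y, z, -, -, -, -, -, -, hiso⟩ := exists_dsum he hi
  refine hx.2 _ _ y z (fun h0 => h.1 ((rk_eq_zero hi).1 h0)) (fun h0 => ?_) hiso
  exact h.2 (sub_eq_zero.1 ((rk_eq_zero hi.one_sub).1 h0)).symm

theorem summand_inclusions {β γ δ : I → ℕ} {x : Rep src tgt K β} {y : Rep src tgt K γ}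
    {z : Rep src tgt K δ} (h : RepIso src tgt x (dsum src tgt y z)) :
    ∃ (i : ∀ v, Matrix (Fin (β v)) (Fin (γ v)) K) (p : ∀ v, Matrix (Fin (γ v)) (Fin (β v)) K)
      (j : ∀ v, Matrix (Fin (β v)) (Fin (δ v)) K) (q : ∀ v, Matrix (Fin (δ v)) (Fin (β v)) K),
      IsHom src tgt y x i ∧ IsHom src tgt x y p ∧
      (∀ v, p v * i v = 1) ∧ (∀ v, q v * j v = 1) ∧ (∀ v, q v * i v = 0) := by
  obtain ⟨u, w, hu, h1, h2⟩ := repIso_iff.1 h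
  obtain ⟨i, p, j, q, hi, hp, h3, h4, h5⟩ := dsum_inclusions y z
  have aux : ∀ v {a b : ℕ} (P : Matrix (Fin a) (Fin ((γ + δ) v)) K)
      (Q : Matrix (Fin ((γ + δ) v)) (Fin b) K), (P * u v) * (w v * Q) = P * Q := by
    intro v a b P Q
    rw [Matrix.mul_assoc, ← Matrix.mul_assoc (u v), h1, Matrix.one_mul]
  refine ⟨fun v => w v * i v, fun v => p v * u v, fun v => w v * j v, fun v => q v * u v,
    (isHom_inv hu h1 h2).comp hi, hp.comp hu, fun v => ?_, fun v => ?_, fun v => ?_⟩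
  · rw [aux, h3]
  · rw [aux, h4]
  · rw [aux, h5]

theorem indec_of_idempotents {β : I → ℕ} {x : Rep src tgt K β} (hβ : β ≠ 0)
    (h : ∀ e ∈ endAlg src tgt x, IsIdempotentElem e → e = 0 ∨ e = 1) : Indec src tgt x := by
  refine ⟨hβ, fun γ δ y z hγ hδ hiso => ?_⟩
  obtain ⟨i, p, j, q, hi, hp, h1, h2, h3⟩ := summand_inclusions hiso
  have hz : ∀ (κ : I → ℕ), (∀ v, (1 : Matrix (Fin (κ v)) (Fin (κ v)) K) = 0) → κ = 0 := by
    intro κ hκ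
    funext v
    have := congrArg Matrix.rank (hκ v)
    simpa using this
  rcases h (fun v => i v * p v) (hi.comp hp) (by
      funext v
      change i v * p v * (i v * p v) = i v * p v
      rw [Matrix.mul_assoc, ← Matrix.mul_assoc (p v), h1, Matrix.one_mul]) with h0 | h0
  · refine hγ (hz γ fun v => ?_)
    have h0v : i v * p v = 0 := congrFun h0 v
    calc (1 : Matrix _ _ K) = (p v * i v) * (p v * i v) := by rw [h1, Matrix.one_mul]
      _ = p v * (i v * p v) * i v := by simp only [Matrix.mul_assoc]
      _ = 0 := by rw [h0v]; simp
  · refine hδ (hz δ fun v => ?_)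
    have h0v : i v * p v = 1 := congrFun h0 v
    calc (1 : Matrix _ _ K) = q v * (i v * p v) * j v := by rw [h0v, Matrix.mul_one, h2]
      _ = (q v * i v) * p v * j v := by simp only [Matrix.mul_assoc]
      _ = 0 := by rw [h3]; simp

theorem IsPrim.transport {β γ : I → ℕ} {x : Rep src tgt K β} {y : Rep src tgt K γ}
    {e : Tup K β} (he : IsPrim (endAlg src tgt x) e)
    {u : ∀ v, Matrix (Fin (γ v)) (Fin (β v)) K} {w : ∀ v, Matrix (Fin (β v)) (Fin (γ v)) K}
    (hu : IsHom src tgt x y u) (hw : IsHom src tgt y x w) (hwu : ∀ v, w v * u v = e v)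
    (hue : ∀ v, u v * e v = u v) :
    IsPrim (endAlg src tgt y) (fun v => u v * w v) ∧ rk (fun v => u v * w v) = rk e := by
  have hee : ∀ v, e v * e v = e v := fun v => idem_apply he.idem v
  have hidem : ∀ v, (u v * w v) * (u v * w v) = u v * w v := by
    intro v
    rw [Matrix.mul_assoc, ← Matrix.mul_assoc (w v), hwu, ← Matrix.mul_assoc, hue]
  refine ⟨⟨hu.comp hw, funext hidem, fun h0 => he.ne_zero ?_, fun f hf hfi h1 h2 => ?_⟩, ?_⟩
  · funext v
    have h0v : u v * w v = 0 := congrFun h0 v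
    calc e v = w v * (u v * w v) * u v := by
          rw [← Matrix.mul_assoc, hwu, Matrix.mul_assoc, hwu, hee]
      _ = 0 := by rw [h0v]; simp
  · have h1v : ∀ v, u v * w v * f v = f v := fun v => congrFun h1 v
    have h2v : ∀ v, f v * (u v * w v) = f v := fun v => congrFun h2 v
    have hback : ∀ v, u v * (w v * f v * u v) * w v = f v := by
      intro v
      calc _ = (u v * w v) * (f v * (u v * w v)) := by simp only [Matrix.mul_assoc]
        _ = f v := by rw [h2v, h1v]
    have hew : ∀ v, e v * (w v * f v) = w v * f v := by
      intro v
      rw [← hwu, Matrix.mul_assoc, ← Matrix.mul_assoc (u v), h1v]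
    rcases he.eq_of_le (fun v => w v * f v * u v) ((hw.comp hf).comp hu) (by
        funext v
        change w v * f v * u v * (w v * f v * u v) = w v * f v * u v
        have hff : f v * f v = f v := idem_apply hfi v
        calc _ = w v * (f v * (u v * w v) * f v) * u v := by simp only [Matrix.mul_assoc]
          _ = _ := by rw [h2v, hff]) (by
        funext v
        change e v * (w v * f v * u v) = w v * f v * u v
        rw [← Matrix.mul_assoc, hew]) (by
        funext v
        change w v * f v * u v * e v = w v * f v * u v
        rw [Matrix.mul_assoc, hue]) with h0 | h0
    · left
      funext v
      have h0v : w v * f v * u v = 0 := congrFun h0 v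
      rw [← hback v, h0v]; simp
    · right
      funext v
      have h0v : w v * f v * u v = e v := congrFun h0 v
      rw [← hback v, h0v, hue]
  · funext v
    have := rank_eq_of_mul_swap (u := u v) (w := w v) (hidem v)
      (by rw [hwu]; exact hee v)
    rw [hwu] at this
    exact this

theorem summands_mem_iff {β : I → ℕ} (x : Rep src tgt K β) (V : Set (I → ℕ)) :
    (∀ (γ δ : I → ℕ) (y : Rep src tgt K γ) (z : Rep src tgt K δ), Indec src tgt y →
      RepIso src tgt x (dsum src tgt y z) → γ ∈ V) ↔
    ∀ e, IsPrim (endAlg src tgt x) e → rk e ∈ V := by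
  constructor
  · intro h e he
    obtain ⟨y, z, i, p, hi, hp, h1, h2, hiso⟩ := exists_dsum he.mem he.idem
    refine h _ _ y z (indec_of_idempotents
      (fun h0 => he.ne_zero ((rk_eq_zero he.idem).1 h0)) fun f hf hfi => ?_) hiso
    have hp' : ∀ v, p v * e v = p v := fun v => by
      rw [← h1, ← Matrix.mul_assoc, h2, Matrix.one_mul]
    have ht := (he.transport hp hi h1 hp').1
    have h1' : (fun v => p v * i v) = (1 : Tup K (rk e)) := funext h2
    rw [h1'] at ht
    exact ht.eq_of_le f hf hfi (one_mul _) (mul_one _)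
  · intro h γ δ y z hy hiso
    obtain ⟨i, p, -, -, hi, hp, h1, -, -⟩ := summand_inclusions hiso
    have hone : IsPrim (endAlg src tgt y) 1 := by
      refine ⟨one_mem _, IsIdempotentElem.one, fun h0 => hy.1 ?_, fun f hf hfi _ _ =>
        idempotent_eq_of_indec hy hf hfi⟩
      have := (rk_eq_zero IsIdempotentElem.one).2 h0
      rw [← this]
      funext v
      simp [rk]
    have := hone.transport hi hp h1 (fun v => Matrix.mul_one _)
    have h2 := h _ this.1
    rw [this.2] at h2
    convert h2 using 1
    funext v
    simp [rk]

end Hom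

section BaseChange

variable {I Ω : Type} {src tgt : Ω → I} {F : Type} [Field F]

theorem IsHom.map {L : Type} [Field L] (f : F →+* L) {β γ : I → ℕ} {x : Rep src tgt F β}
    {y : Rep src tgt F γ} {u : ∀ v, Matrix (Fin (γ v)) (Fin (β v)) F}
    (hu : IsHom src tgt x y u) :
    IsHom src tgt (baseChange src tgt f x) (baseChange src tgt f y) (fun v => (u v).map f) := by
  intro a
  have h := congrArg (fun M => M.map f) (hu a)
  have h1 : (u (tgt a) * x a).map f = (u (tgt a)).map f * (x a).map f := Matrix.map_mul
  have h2 : (y a * u (src a)).map f = (y a).map f * (u (src a)).map f := Matrix.map_mul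
  exact h1.symm.trans (h.trans h2)

theorem mapTup_mem_endAlg {L : Type} [Field L] (f : F →+* L) {β : I → ℕ} {x : Rep src tgt F β}
    {g : Tup F β} (hg : g ∈ endAlg src tgt x) :
    mapTup f β g ∈ endAlg src tgt (baseChange src tgt f x) :=
  IsHom.map f hg

variable {L : Type} [Field L] [Algebra F L]

theorem map_linear_mul {a b c : ℕ} (l : L →ₗ[F] F) (M : Matrix (Fin a) (Fin b) L)
    (X : Matrix (Fin b) (Fin c) F) :
    (M * X.map (algebraMap F L)).map l = M.map l * X := by
  ext i j
  simp only [Matrix.map_apply, Matrix.mul_apply, map_sum]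
  refine Finset.sum_congr rfl fun k _ => ?_
  rw [mul_comm, ← Algebra.smul_def, map_smul, smul_eq_mul, mul_comm]

theorem map_mul_linear {a b c : ℕ} (l : L →ₗ[F] F) (X : Matrix (Fin a) (Fin b) F)
    (M : Matrix (Fin b) (Fin c) L) :
    (X.map (algebraMap F L) * M).map l = X * M.map l := by
  ext i j
  simp only [Matrix.map_apply, Matrix.mul_apply, map_sum]
  refine Finset.sum_congr rfl fun k _ => ?_
  rw [← Algebra.smul_def, map_smul, smul_eq_mul]

theorem mem_span_endAlg [Fintype I] {β : I → ℕ} {x : Rep src tgt F β} {M : Tup L β}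
    (hM : M ∈ endAlg src tgt (baseChange src tgt (algebraMap F L) x)) :
    M ∈ Submodule.span L (mapTup (algebraMap F L) β '' (endAlg src tgt x : Set (Tup F β))) := by
  let b := Module.Basis.ofVectorSpace F L
  let N : _ → Tup F β := fun t v => (M v).map (b.coord t)
  have hN : ∀ t, N t ∈ endAlg src tgt x := by
    intro t a
    have h := congrArg (fun A => A.map (b.coord t)) (hM a)
    exact (map_linear_mul (b.coord t) (M (tgt a)) (x a)).symm.trans
      (h.trans (map_mul_linear (b.coord t) (x a) (M (src a))))
  let s := Finset.univ.biUnion fun v : I => Finset.univ.biUnion fun i : Fin (β v) =>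
    Finset.univ.biUnion fun j : Fin (β v) => (b.repr (M v i j)).support
  have hsum : M = ∑ t ∈ s, b t • mapTup (algebraMap F L) β (N t) := by
    funext v
    ext i j
    have hsub : (b.repr (M v i j)).support ⊆ s := fun t ht =>
      Finset.mem_biUnion.2 ⟨v, Finset.mem_univ _, Finset.mem_biUnion.2 ⟨i, Finset.mem_univ _,
        Finset.mem_biUnion.2 ⟨j, Finset.mem_univ _, ht⟩⟩⟩
    have h1 := b.linearCombination_repr (M v i j)
    rw [Finsupp.linearCombination_apply,
      Finsupp.sum_of_support_subset _ hsub _ (by intro t _; exact zero_smul F (b t))] at h1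
    rw [Finset.sum_apply, Matrix.sum_apply, ← h1]
    refine Finset.sum_congr rfl fun t _ => ?_
    rw [Algebra.smul_def, mul_comm]
    rfl
  rw [hsum]
  exact Submodule.sum_mem _ fun t _ =>
    Submodule.smul_mem _ _ (Submodule.subset_span ⟨N t, hN t, rfl⟩)

theorem exists_pow_isIdempotentElem_tup [Fintype I] [Finite F] [Algebra.IsAlgebraic F L]
    {β : I → ℕ} (y : Tup L β) : ∃ N : ℕ, 1 ≤ N ∧ IsIdempotentElem (y ^ N) := by
  let S : Set L := Set.range fun t : (Σ v, Fin (β v) × Fin (β v)) => y t.1 t.2.1 t.2.2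
  let E := IntermediateField.adjoin F S
  have hfin : FiniteDimensional F E := by
    have : Finite S := Set.finite_range _
    exact IntermediateField.finiteDimensional_adjoin fun z _ =>
      (Algebra.IsAlgebraic.isAlgebraic z).isIntegral
  have : Finite E := Module.finite_of_finite F
  let y' : Tup E β := fun v => Matrix.of fun i j =>
    ⟨y v i j, IntermediateField.subset_adjoin F S ⟨⟨v, i, j⟩, rfl⟩⟩
  have hy : mapTup (algebraMap E L) β y' = y := rfl
  have : Finite (Tup E β) := by
    have : ∀ v, Finite (Matrix (Fin (β v)) (Fin (β v)) E) := fun v =>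
      inferInstanceAs (Finite (Fin (β v) → Fin (β v) → E))
    exact Pi.finite
  obtain ⟨N, h1, h2⟩ := exists_pow_isIdempotentElem y'
  refine ⟨N, h1, ?_⟩
  rw [← hy, ← map_pow]
  exact h2.map _

end BaseChange

section FiniteLocal

variable {F : Type*} [Field F]

/-- A finite division algebra over `F` is generated by an element whose norm generates `Fˣ`. -/
theorem exists_generator (D : Type*) [DivisionRing D] [Finite D] [Algebra F D] :
    ∃ (g : D) (P : Polynomial F), P.Monic ∧ Irreducible P ∧ Polynomial.aeval g P = 0 ∧
      P.coeff 0 ≠ 0 ∧ (∀ b : D, ∃ p : Polynomial F, b = Polynomial.aeval g p) ∧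
      ∀ c : F, c ≠ 0 → ∃ k : ℕ, c = ((-1) ^ P.natDegree * P.coeff 0) ^ k := by
  let : Field D := littleWedderburn D
  obtain ⟨u, hu⟩ := IsCyclic.exists_generator (α := Dˣ)
  have hpow : ∀ b : D, b ≠ 0 → ∃ k : ℕ, b = (u : D) ^ k := by
    intro b hb
    obtain ⟨k, hk⟩ := (mem_powers_iff_mem_zpowers).2 (hu (Units.mk0 b hb))
    exact ⟨k, by simpa using (congrArg Units.val hk).symm⟩
  have hintegral : IsIntegral F (u : D) := Algebra.IsIntegral.isIntegral _
  have hgen : ∀ b : D, ∃ p : Polynomial F, b = Polynomial.aeval (u : D) p := by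
    intro b
    by_cases hb : b = 0
    · exact ⟨0, by simp [hb]⟩
    · obtain ⟨k, hk⟩ := hpow b hb
      exact ⟨Polynomial.X ^ k, by simp [hk]⟩
  have htop : Algebra.adjoin F {(u : D)} = ⊤ := by
    rw [eq_top_iff]
    intro b _
    obtain ⟨p, rfl⟩ := hgen b
    exact Polynomial.aeval_mem_adjoin_singleton _ _
  have hnorm : Algebra.norm F (u : D)
      = (-1) ^ (minpoly F (u : D)).natDegree * (minpoly F (u : D)).coeff 0 := by
    have h := Algebra.PowerBasis.norm_gen_eq_coeff_zero_minpoly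
      (PowerBasis.ofAdjoinEqTop hintegral htop)
    rwa [← PowerBasis.natDegree_minpoly, PowerBasis.ofAdjoinEqTop_gen] at h
  refine ⟨u, minpoly F (u : D), minpoly.monic hintegral, minpoly.irreducible hintegral,
    minpoly.aeval _ _,
    minpoly.coeff_zero_ne_zero hintegral u.ne_zero, hgen, fun c hc => ?_⟩
  obtain ⟨b, rfl⟩ := FiniteField.norm_surjective F D c
  obtain ⟨k, rfl⟩ := hpow b (by rintro rfl; simp at hc)
  exact ⟨k, by rw [map_pow, hnorm]⟩

theorem isUnit_or_isNilpotent {A : Type*} [Ring A] [Finite A]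
    (h : ∀ e : A, IsIdempotentElem e → e = 0 ∨ e = 1) (b : A) : IsUnit b ∨ IsNilpotent b := by
  obtain ⟨N, hN, hi⟩ := exists_pow_isIdempotentElem b
  rcases h _ hi with h0 | h1
  · exact Or.inr ⟨N, h0⟩
  · exact Or.inl ((isUnit_pow_iff (by omega)).1 (h1 ▸ isUnit_one))

theorem mem_jacobson_of_isNilpotent {A : Type*} [Ring A] [Finite A]
    (h : ∀ e : A, IsIdempotentElem e → e = 0 ∨ e = 1) {b : A} (hb : IsNilpotent b) :
    b ∈ Ideal.jacobson (⊥ : Ideal A) := by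
  rw [Ideal.mem_jacobson_iff]
  intro y
  rcases subsingleton_or_nontrivial A with hA | hA
  · exact ⟨0, Subsingleton.elim _ _⟩
  have hyb : IsNilpotent (y * b) := by
    refine (isUnit_or_isNilpotent h (y * b)).resolve_left fun hu => ?_
    obtain ⟨z, hz⟩ := hu.exists_left_inv
    have hreg : IsLeftRegular b := fun s t hst => by
      have hst' : b * s = b * t := hst
      calc s = z * (y * b) * s := by rw [hz, one_mul]
        _ = z * y * (b * s) := by simp only [mul_assoc]
        _ = z * (y * b) * t := by rw [hst']; simp only [mul_assoc]
        _ = t := by rw [hz, one_mul]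
    obtain ⟨k, hk⟩ := hb
    have := hreg.pow k
    rw [hk] at this
    exact one_ne_zero (this (show (0 : A) * 1 = 0 * 0 by simp))
  obtain ⟨z, hz⟩ := hyb.isUnit_one_add.exists_left_inv
  refine ⟨z, ?_⟩
  rw [Ideal.mem_bot, sub_eq_zero, ← hz]
  rw [mul_add, mul_one, mul_assoc, add_comm]

/-- A finite local algebra has a generator modulo its radical that is annihilated by an irreducible
polynomial. -/
theorem exists_generator_local [Finite F] (A : Type*) [Ring A] [Finite A] [Algebra F A]
    [Nontrivial A]
    (h : ∀ e : A, IsIdempotentElem e → e = 0 ∨ e = 1) :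
    ∃ (J : Ideal A) (_ : J.IsTwoSided) (M : ℕ) (a : A) (P : Polynomial F), J ^ M = ⊥ ∧ P.Monic ∧
      Irreducible P ∧ Polynomial.aeval a P = 0 ∧ P.coeff 0 ≠ 0 ∧
      (∀ b : A, ∃ p : Polynomial F, b - Polynomial.aeval a p ∈ J) ∧
      ∀ c : F, c ≠ 0 → ∃ k : ℕ, c = ((-1) ^ P.natDegree * P.coeff 0) ^ k := by
  set J := Ideal.jacobson (⊥ : Ideal A) with hJ
  obtain ⟨M, hM⟩ := IsArtinianRing.isNilpotent_jacobson_bot (R := A)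
  have hJtop : J ≠ ⊤ := by
    rw [hJ, Ne, Ideal.jacobson_eq_top_iff]
    exact bot_ne_top
  have : Nontrivial (A ⧸ J) := Ideal.Quotient.nontrivial_iff.2 hJtop
  have hD : ∀ d : A ⧸ J, IsUnit d ∨ d = 0 := by
    intro d
    obtain ⟨b, rfl⟩ := Ideal.Quotient.mk_surjective d
    rcases isUnit_or_isNilpotent h b with hb | hb
    · exact Or.inl (hb.map _)
    · exact Or.inr (Ideal.Quotient.eq_zero_iff_mem.2 (mem_jacobson_of_isNilpotent h hb))
  let : DivisionRing (A ⧸ J) := DivisionRing.ofIsUnitOrEqZero hD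
  have : Finite (A ⧸ J) := Finite.of_surjective _ Ideal.Quotient.mk_surjective
  obtain ⟨g, P, hP1, hP2, hP3, hP0, hP4, hP5⟩ := exists_generator (F := F) (A ⧸ J)
  obtain ⟨a₀, rfl⟩ := Ideal.Quotient.mk_surjective g
  let := Fintype.ofFinite F
  let := Fintype.ofFinite (A ⧸ J)
  set Q := Fintype.card (A ⧸ J) with hQ
  have hmk : ∀ (b : A) (p : Polynomial F), Ideal.Quotient.mk J (Polynomial.aeval b p)
      = Polynomial.aeval (Ideal.Quotient.mk J b) p := fun b p =>
    (Polynomial.aeval_algHom_apply (Ideal.Quotient.mkₐ F J) b p).symm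
  have hpow : Ideal.Quotient.mk J (a₀ ^ Q ^ M) = Ideal.Quotient.mk J a₀ := by
    rw [map_pow, hQ]
    exact FiniteField.pow_card_pow M _
  refine ⟨J, inferInstance, M, a₀ ^ Q ^ M, P, hM, hP1, hP2, ?_, hP0, fun b => ?_, hP5⟩
  · obtain ⟨d, hd⟩ : ∃ d : ℕ, Q ^ M = Fintype.card F ^ d :=
      ⟨Module.finrank F (A ⧸ J) * M, by
        rw [hQ, Module.card_eq_pow_finrank (K := F) (V := A ⧸ J), pow_mul]⟩
    have hexp : ∀ (d : ℕ) (b : A), Polynomial.aeval (b ^ Fintype.card F ^ d) P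
        = (Polynomial.aeval b P) ^ Fintype.card F ^ d := by
      intro d
      induction d with
      | zero => intro b; simp
      | succ d ih =>
        intro b
        rw [pow_succ, pow_mul, pow_mul, ← ih, ← map_pow, ← FiniteField.expand_card,
          Polynomial.expand_aeval]
    have hmem : Polynomial.aeval a₀ P ∈ J := by
      rw [← Ideal.Quotient.eq_zero_iff_mem, hmk, hP3]
    have hle : M ≤ Q ^ M := (Nat.lt_pow_self Fintype.one_lt_card).le
    rw [hd, hexp, ← hd]
    have h0 : (Polynomial.aeval a₀ P) ^ M = 0 := by
      have := Ideal.pow_mem_pow hmem M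
      rw [hM] at this
      exact this
    rw [← Nat.add_sub_of_le hle, pow_add, h0, zero_mul]
  · obtain ⟨p, hp⟩ := hP4 (Ideal.Quotient.mk J b)
    exact ⟨p, by rw [← Ideal.Quotient.eq_zero_iff_mem, map_sub, hmk, hpow, hp, sub_self]⟩

end FiniteLocal

section Spectral

variable {I : Type}

theorem det_sum_smul_idempotent {K ι : Type*} [Field K] {β : I → ℕ} (S : Finset ι)
    (e : ι → Tup K β) (h : ∀ i ∈ S, ∀ j ∈ S, e i * e j = if i = j then e i else 0)
    (c : ι → K) (v : I) :
    ((1 + ∑ i ∈ S, (c i - 1) • e i : Tup K β) v).det = ∏ i ∈ S, c i ^ rk (e i) v := by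
  induction S using Finset.induction_on with
  | empty => simp
  | insert a S ha ih =>
    have hS : ∀ i ∈ S, ∀ j ∈ S, e i * e j = if i = j then e i else 0 := fun i hi j hj =>
      h i (Finset.mem_insert_of_mem hi) j (Finset.mem_insert_of_mem hj)
    have hid : IsIdempotentElem (e a) :=
      (h a (Finset.mem_insert_self _ _) a (Finset.mem_insert_self _ _)).trans (if_pos rfl)
    have hmul : (1 + ∑ i ∈ insert a S, (c i - 1) • e i : Tup K β)
        = (1 + (c a - 1) • e a) * (1 + ∑ i ∈ S, (c i - 1) • e i) := by
      have h0 : (c a - 1) • e a * ∑ i ∈ S, (c i - 1) • e i = 0 := by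
        rw [Finset.mul_sum]
        refine Finset.sum_eq_zero fun j hj => ?_
        have hne : a ≠ j := fun haj => ha (haj ▸ hj)
        rw [smul_mul_smul_comm, h a (Finset.mem_insert_self _ _) j (Finset.mem_insert_of_mem hj),
          if_neg hne, smul_zero]
      rw [Finset.sum_insert ha, add_mul, one_mul, mul_add, h0, mul_one]
      abel
    rw [hmul, Finset.prod_insert ha, ← ih hS, Pi.mul_apply, Matrix.det_mul]
    congr 1
    exact det_one_add_smul_idempotent _ (idem_apply hid v) _

variable {K : Type*} [Field K] {β : I → ℕ} {a : Tup K β} {S : Finset K}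

theorem det_eq_prod_specProj
    (h : Polynomial.aeval a (∏ l ∈ S, (Polynomial.X - Polynomial.C l)) = 0) (v : I) :
    (a v).det = ∏ l ∈ S, l ^ rk (specProj a S l) v := by
  have h0 := det_sum_smul_idempotent S (specProj a S) (fun l hl m hm => specProj_mul h hl hm) id v
  have h1 : a = ∑ l ∈ S, l • specProj a S l := by
    simpa using aeval_eq_sum_specProj h Polynomial.X
  have h2 : (1 + ∑ l ∈ S, (id l - 1) • specProj a S l : Tup K β) = a := by
    conv_rhs => rw [h1]
    simp only [id, sub_smul, one_smul, Finset.sum_sub_distrib, sum_specProj h]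
    abel
  rwa [h2] at h0

theorem isIdempotentElem_specProj
    (h : Polynomial.aeval a (∏ l ∈ S, (Polynomial.X - Polynomial.C l)) = 0) {l : K}
    (hl : l ∈ S) : IsIdempotentElem (specProj a S l) :=
  (specProj_mul h hl hl).trans (if_pos rfl)

/-- An idempotent polynomial in `a` is a sum of spectral projections of `a`. -/
theorem exists_eq_sum_specProj
    (h : Polynomial.aeval a (∏ l ∈ S, (Polynomial.X - Polynomial.C l)) = 0)
    {p : Polynomial K} (hp : IsIdempotentElem (Polynomial.aeval a p)) :
    ∃ T ⊆ S, Polynomial.aeval a p = ∑ l ∈ T, specProj a S l := by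
  refine ⟨S.filter fun l => p.eval l = 1, Finset.filter_subset _ _, ?_⟩
  rw [Finset.sum_filter, aeval_eq_sum_specProj h p]
  refine Finset.sum_congr rfl fun l hl => ?_
  have h1 := mul_specProj h p hl
  have h2 : Polynomial.aeval a p * (Polynomial.aeval a p * specProj a S l)
      = p.eval l • (p.eval l • specProj a S l) := by
    rw [h1, mul_smul_comm, h1]
  rw [← mul_assoc, hp.eq, h1] at h2
  split_ifs with h3
  · rw [h3, one_smul]
  · by_contra h4
    have h5 : (p.eval l * (p.eval l - 1)) • specProj a S l = 0 := by
      rw [mul_sub, mul_one, sub_smul, mul_smul, ← h2, sub_self]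
    have h6 : specProj a S l ≠ 0 := fun h6 => h4 (by rw [h6, smul_zero])
    have h7 : p.eval l ≠ 0 := fun h7 => h4 (by rw [h7, zero_smul])
    exact (mul_ne_zero h7 (sub_ne_zero.2 h3)) ((smul_eq_zero.1 h5).resolve_right h6)

theorem map_aeval_mapTup {L : Type*} [Field L] (f : K →+* L) (p : Polynomial K) (a : Tup K β) :
    mapTup f β (Polynomial.aeval a p) = Polynomial.aeval (mapTup f β a) (p.map f) := by
  induction p using Polynomial.induction_on' with
  | add p q hp hq => simp only [map_add, hp, hq, Polynomial.map_add]
  | monomial n c =>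
    simp only [Polynomial.aeval_monomial, Polynomial.map_monomial, map_mul, map_pow,
      Algebra.algebraMap_eq_smul_one, mapTup_smul, map_one]

theorem map_lagrange_basis (S : Finset K) (f : K ≃+* K) (hf : S.map f.toEquiv.toEmbedding = S)
    (l : K) : (Lagrange.basis S id l).map (f : K →+* K) = Lagrange.basis S id (f l) := by
  rw [Lagrange.basis, Lagrange.basis, Polynomial.map_prod]
  have h : S.erase (f l) = (S.erase l).map f.toEquiv.toEmbedding := by
    conv_lhs => rw [← hf]
    rw [Finset.map_erase]
    rfl
  rw [h, Finset.prod_map]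
  refine Finset.prod_congr rfl fun j _ => ?_
  simp [Lagrange.basisDivisor]

/-- Galois conjugate eigenvalues have spectral projections of the same rank. -/
theorem rk_specProj_galois {F : Type*} [Field F] [Algebra F K] (a : Tup F β)
    (h : Polynomial.aeval (mapTup (algebraMap F K) β a)
      (∏ l ∈ S, (Polynomial.X - Polynomial.C l)) = 0)
    (f : K ≃ₐ[F] K) (hf : ∀ l ∈ S, f l ∈ S) {l : K} (hl : l ∈ S) :
    rk (specProj (mapTup (algebraMap F K) β a) S (f l))
      = rk (specProj (mapTup (algebraMap F K) β a) S l) := by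
  have hS : S.map (f : K ≃+* K).toEquiv.toEmbedding = S := by
    apply Finset.eq_of_subset_of_card_le
    · intro x hx
      obtain ⟨y, hy, rfl⟩ := Finset.mem_map.1 hx
      exact hf y hy
    · rw [Finset.card_map]
  rw [← rk_mapTup ((f : K ≃+* K) : K →+* K) (isIdempotentElem_specProj h hl)]
  congr 1
  rw [specProj, specProj, map_aeval_mapTup, map_lagrange_basis S (f : K ≃+* K) hS]
  congr 2
  funext v
  ext i j
  exact (f.commutes (a v i j)).symm

end Spectral

section Roots

variable {F : Type*} [Field F] {L : Type*} [Field L] [Algebra F L] {P : Polynomial F}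

theorem mem_roots_toFinset_iff (h1 : P.Monic) (l : L) :
    l ∈ (P.map (algebraMap F L)).roots.toFinset ↔ Polynomial.aeval l P = 0 := by
  rw [Multiset.mem_toFinset, Polynomial.mem_roots (h1.map _).ne_zero, Polynomial.IsRoot.def,
    Polynomial.eval_map_algebraMap]

variable [IsAlgClosed L]

theorem prod_X_sub_roots_of_separable (h1 : P.Monic) (h2 : P.Separable) :
    ∏ l ∈ (P.map (algebraMap F L)).roots.toFinset, (Polynomial.X - Polynomial.C l)
      = P.map (algebraMap F L) := by
  have hsep : (P.map (algebraMap F L)).Separable := h2.map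
  conv_rhs => rw [(IsAlgClosed.splits (P.map (algebraMap F L))).eq_prod_roots_of_monic (h1.map _)]
  rw [Finset.prod, Multiset.toFinset_val, (Polynomial.nodup_roots hsep).dedup]

variable [Finite F]

theorem prod_X_sub_roots (h1 : P.Monic) (h2 : Irreducible P) :
    ∏ l ∈ (P.map (algebraMap F L)).roots.toFinset, (Polynomial.X - Polynomial.C l)
      = P.map (algebraMap F L) :=
  prod_X_sub_roots_of_separable h1 (PerfectField.separable_of_irreducible h2)

theorem prod_roots (h1 : P.Monic) (h2 : Irreducible P) :
    ∏ l ∈ (P.map (algebraMap F L)).roots.toFinset, l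
      = algebraMap F L ((-1) ^ P.natDegree * P.coeff 0) := by
  have h := congrArg (fun p : Polynomial L => p.coeff 0) (prod_X_sub_roots (L := L) h1 h2)
  have hsep : (P.map (algebraMap F L)).Separable :=
    (PerfectField.separable_of_irreducible h2).map
  have h3 := (IsAlgClosed.splits (P.map (algebraMap F L))).coeff_zero_eq_prod_roots_of_monic
    (h1.map _)
  rw [Polynomial.coeff_map, Polynomial.natDegree_map] at h3
  rw [map_mul, h3, map_pow, map_neg, map_one, ← mul_assoc, ← mul_pow, neg_one_mul, neg_neg, one_pow,
    one_mul, Finset.prod, Multiset.toFinset_val, (Polynomial.nodup_roots hsep).dedup,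
    Multiset.map_id']

end Roots

section Local

variable {I : Type}

theorem rk_eq_of_isNilpotent {K : Type*} [Field K] {β : I → ℕ} {e f : Tup K β}
    (he : IsIdempotentElem e) (hf : IsIdempotentElem f) (h1 : IsNilpotent (e * (e - f) * e))
    (h2 : IsNilpotent (f * (f - e) * f)) : rk e = rk f := by
  have key : ∀ {a b : Tup K β}, IsIdempotentElem b → IsNilpotent (b * (b - a) * b) →
      ∀ v, rk b v ≤ rk a v := by
    intro a b hb ⟨N, hN⟩ v
    exact rank_le_of_isNilpotent_sub _ _ (idem_apply hb v) ⟨N, congrFun hN v⟩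
  exact funext fun v => le_antisymm (key he h1 v) (key hf h2 v)

variable [Fintype I]

/-- The dimension vectors on which a tuple of characters is trivial. -/
def charKer {K : Type*} [Field K] (σ : I → (Kˣ →* ℂˣ)) : AddSubmonoid (I → ℕ) where
  carrier := {δ | ∏ v, σ v ^ δ v = 1}
  zero_mem' := Finset.prod_eq_one fun v _ => pow_zero (σ v)
  add_mem' {a b} ha hb := by
    refine (Finset.prod_congr rfl fun v _ => pow_add (σ v) (a v) (b v)).trans ?_
    have ha' : ∏ v, σ v ^ a v = 1 := ha
    have hb' : ∏ v, σ v ^ b v = 1 := hb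
    rw [Finset.prod_mul_distrib, ha', hb']
    exact one_mul (1 : Kˣ →* ℂˣ)

theorem prod_pow_apply {K : Type*} [Field K] (σ : I → (Kˣ →* ℂˣ)) (δ : I → ℕ) (u : Kˣ) :
    ∏ v, σ v (u ^ δ v) = (∏ v, σ v ^ δ v) u := by
  rw [MonoidHom.finsetProd_apply]
  exact Finset.prod_congr rfl fun v _ => by rw [map_pow]; rfl

variable {Ω : Type} {src tgt : Ω → I} {F : Type} [Field F]

variable (src tgt) in
/-- The character of the automorphism group attached to `σ` is trivial. -/
def DetTrivial (σ : I → (Fˣ →* ℂˣ)) {β : I → ℕ} (x : Rep src tgt F β) : Prop :=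
  ∀ g : Tup F β, IsHom src tgt x x g → ∀ d : I → Fˣ, (∀ v, (g v).det = d v) → ∏ v, σ v (d v) = 1

variable {L : Type} [Field L] [Algebra F L]

theorem exists_sub_aeval_mem_span {β : I → ℕ} {x : Rep src tgt F β}
    {J : Ideal (endAlg src tgt x)} {a : endAlg src tgt x}
    (h : ∀ b, ∃ p : Polynomial F, b - Polynomial.aeval a p ∈ J) {e : Tup L β}
    (he : e ∈ endAlg src tgt (baseChange src tgt (algebraMap F L) x)) :
    ∃ p : Polynomial L, e - Polynomial.aeval (mapTup (algebraMap F L) β a) p ∈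
      Submodule.span L ((fun b : endAlg src tgt x => mapTup (algebraMap F L) β b) '' J) := by
  have he' := mem_span_endAlg he
  clear he
  induction he' using Submodule.span_induction with
  | mem y hy =>
    obtain ⟨b, hb, rfl⟩ := hy
    obtain ⟨p, hp⟩ := h ⟨b, hb⟩
    refine ⟨p.map (algebraMap F L), Submodule.subset_span ⟨_, hp, ?_⟩⟩
    have : ((Polynomial.aeval a p : endAlg src tgt x) : Tup F β)
        = Polynomial.aeval (a : Tup F β) p :=
      (Polynomial.aeval_algHom_apply (endAlg src tgt x).val a p).symm
    simp only [AddSubgroupClass.coe_sub, this, map_sub, map_aeval_mapTup]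
  | zero => exact ⟨0, by simp⟩
  | add y z _ _ hy hz =>
    obtain ⟨p, hp⟩ := hy
    obtain ⟨q, hq⟩ := hz
    refine ⟨p + q, ?_⟩
    rw [map_add, add_sub_add_comm]
    exact Submodule.add_mem _ hp hq
  | smul c y _ hy =>
    obtain ⟨p, hp⟩ := hy
    refine ⟨c • p, ?_⟩
    rw [map_smul, ← smul_sub]
    exact Submodule.smul_mem _ _ hp

variable [Finite F] [IsAlgClosed L] [Normal F L]

theorem rk_specProj_mem_charKer {σ : I → (Fˣ →* ℂˣ)} {β : I → ℕ}
    {x : Rep src tgt F β} (hσ : DetTrivial src tgt σ x) {a : Tup F β} (ha : a ∈ endAlg src tgt x)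
    {P : Polynomial F} (h1 : P.Monic) (h2 : Irreducible P) (h3 : Polynomial.aeval a P = 0)
    (h0 : P.coeff 0 ≠ 0) (h4 : ∀ c : F, c ≠ 0 → ∃ k : ℕ, c = ((-1) ^ P.natDegree * P.coeff 0) ^ k)
    {l : L}
    (hl : l ∈ (P.map (algebraMap F L)).roots.toFinset) :
    rk (specProj (mapTup (algebraMap F L) β a) (P.map (algebraMap F L)).roots.toFinset l)
      ∈ charKer σ := by
  set S := (P.map (algebraMap F L)).roots.toFinset
  set δ := rk (specProj (mapTup (algebraMap F L) β a) S l) with hδ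
  have hS : Polynomial.aeval (mapTup (algebraMap F L) β a)
      (∏ l ∈ S, (Polynomial.X - Polynomial.C l)) = 0 := by
    rw [prod_X_sub_roots h1 h2, ← map_aeval_mapTup, h3, map_zero]
  have hall : ∀ m ∈ S, rk (specProj (mapTup (algebraMap F L) β a) S m) = δ := by
    intro m hm
    have hm0 := (mem_roots_toFinset_iff h1 m).1 hm
    have hl0 := (mem_roots_toFinset_iff h1 l).1 hl
    have hmin : P = minpoly F l := minpoly.eq_of_irreducible_of_monic h2 hl0 h1
    obtain ⟨f, hf⟩ := minpoly.exists_algEquiv_of_root' (x := m) (y := l)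
      (Algebra.IsAlgebraic.isAlgebraic l) (by rwa [← hmin])
    rw [← hf, hδ]
    refine rk_specProj_galois a hS f (fun k hk => ?_) hl
    rw [mem_roots_toFinset_iff h1] at hk ⊢
    exact (Polynomial.aeval_algHom_apply f.toAlgHom k P).trans (by rw [hk, map_zero])
  set N := (-1) ^ P.natDegree * P.coeff 0 with hN
  have hN0 : N ≠ 0 :=
     mul_ne_zero (pow_ne_zero _ (neg_ne_zero.2 one_ne_zero)) h0
  have hdet : ∀ v, (a v).det = N ^ δ v := by
    intro v
    apply (algebraMap F L).injective
    have h5 := det_eq_prod_specProj hS v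
    rw [Finset.prod_congr rfl (fun m hm => by rw [hall m hm]), Finset.prod_pow,
      prod_roots h1 h2, ← map_pow] at h5
    rw [← h5, mapTup_apply]
    exact (algebraMap F L).map_det (a v)
  have h6 := hσ a ha (fun v => Units.mk0 N hN0 ^ δ v) (fun v => by simp [hdet])
  rw [prod_pow_apply] at h6
  change _ = _
  ext u
  obtain ⟨k, hk⟩ := h4 u u.ne_zero
  have : u = Units.mk0 N hN0 ^ k := by ext; simp [hk]
  rw [this, map_pow, h6]
  simp

/-- In the local case the geometric idempotents have ranks in the kernel of the character. -/
theorem rk_mem_charKer_of_local {σ : I → (Fˣ →* ℂˣ)} {β : I → ℕ} (hβ : (1 : Tup F β) ≠ 0)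
    {x : Rep src tgt F β} (hσ : DetTrivial src tgt σ x)
    (hx : ∀ e ∈ endAlg src tgt x, IsIdempotentElem e → e = 0 ∨ e = 1) {e : Tup L β}
    (he : e ∈ endAlg src tgt (baseChange src tgt (algebraMap F L) x)) (hi : IsIdempotentElem e) :
    rk e ∈ charKer σ := by
  have : Finite (Tup F β) := by
    have : ∀ v, Finite (Matrix (Fin (β v)) (Fin (β v)) F) := fun v =>
      inferInstanceAs (Finite (Fin (β v) → Fin (β v) → F))
    exact Pi.finite
  have : Nontrivial (Tup F β) := ⟨_, _, hβ⟩
  obtain ⟨J, hJ2, M, a, P, hJ, h1, h2, h3, h0, h4, h5⟩ := exists_generator_local (F := F)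
    (endAlg src tgt x) (fun e he => by
      rcases hx e e.2 (congrArg Subtype.val he) with h | h
      · exact Or.inl (Subtype.ext h)
      · exact Or.inr (Subtype.ext h))
  set φ := mapTup (algebraMap F L) β with hφ
  have h3' : Polynomial.aeval (a : Tup F β) P = 0 :=
    (Polynomial.aeval_algHom_apply (endAlg src tgt x).val a P).trans (by rw [h3]; rfl)
  obtain ⟨p, hp⟩ := exists_sub_aeval_mem_span h4 he
  set T : Set (Tup L β) := (fun b : endAlg src tgt x => φ b) '' J with hT
  have hleft : ∀ y ∈ endAlg src tgt (baseChange src tgt (algebraMap F L) x),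
      ∀ z ∈ Submodule.span L T, y * z ∈ Submodule.span L T ∧ z * y ∈ Submodule.span L T := by
    intro y hy z hz
    have hy' := mem_span_endAlg hy
    constructor
    · have := Submodule.mul_mem_mul hy' hz
      rw [Submodule.span_mul_span] at this
      refine Submodule.span_mono ?_ this
      rintro _ ⟨_, ⟨b, hb, rfl⟩, _, ⟨c, hc, rfl⟩, rfl⟩
      exact ⟨⟨b, hb⟩ * c, J.mul_mem_left _ hc, map_mul φ _ _⟩
    · have := Submodule.mul_mem_mul hz hy'
      rw [Submodule.span_mul_span] at this
      refine Submodule.span_mono ?_ this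
      rintro _ ⟨_, ⟨c, hc, rfl⟩, _, ⟨b, hb, rfl⟩, rfl⟩
      exact ⟨c * ⟨b, hb⟩, J.mul_mem_right _ hc, map_mul φ _ _⟩
  have hTpow : ∀ k, T ^ k ⊆ (fun b : endAlg src tgt x => φ b) '' ((J ^ k : Ideal _) : Set _) := by
    intro k
    induction k with
    | zero =>
      rw [pow_zero]
      rintro _ rfl
      exact ⟨1, by rw [Submodule.pow_zero, Ideal.one_eq_top]; exact Submodule.mem_top, map_one φ⟩
    | succ k ih =>
      rw [pow_succ]
      rintro _ ⟨y, hy, z, ⟨c, hc, rfl⟩, rfl⟩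
      obtain ⟨b, hb, rfl⟩ := ih hy
      exact ⟨b * c, by rw [Submodule.pow_succ]; exact Ideal.mul_mem_mul hb hc, map_mul φ _ _⟩
  have hnil : ∀ z ∈ Submodule.span L T, IsNilpotent z := by
    intro z hz
    refine ⟨M, ?_⟩
    have := Submodule.pow_mem_pow _ hz M
    rw [Submodule.span_pow] at this
    have h6 := Submodule.span_mono (hTpow M) this
    rw [hJ] at h6
    have h7 : (fun b : endAlg src tgt x => φ b) '' ((⊥ : Ideal (endAlg src tgt x)) : Set _)
        ⊆ {0} := by
      rintro _ ⟨b, hb, rfl⟩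
      have : b = 0 := hb
      rw [this]
      exact map_zero φ
    have h8 := Submodule.span_mono h7 h6
    rwa [Submodule.span_zero_singleton, Submodule.mem_bot] at h8
  set s := Polynomial.aeval (φ a) p with hs
  have hsE : s ∈ endAlg src tgt (baseChange src tgt (algebraMap F L) x) := by
    have h6 : e - s ∈ endAlg src tgt (baseChange src tgt (algebraMap F L) x) := by
      refine (Submodule.span_le (p := Subalgebra.toSubmodule
        (endAlg src tgt (baseChange src tgt (algebraMap F L) x)))).2 ?_ hp
      rintro _ ⟨b, -, rfl⟩
      exact mapTup_mem_endAlg _ b.2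
    simpa using sub_mem he h6
  obtain ⟨N, hN, hsN⟩ := exists_pow_isIdempotentElem_tup (F := F) s
  have hdiff : ∀ k, e ^ k - s ^ k ∈ Submodule.span L T := by
    intro k
    induction k with
    | zero => simp
    | succ k ih =>
      have : e ^ (k + 1) - s ^ (k + 1) = e ^ k * (e - s) + (e ^ k - s ^ k) * s := by
        rw [pow_succ, pow_succ]; noncomm_ring
      rw [this]
      exact Submodule.add_mem _ (hleft _ (pow_mem he k) _ hp).1 (hleft _ hsE _ ih).2
  have hd := hdiff N
  rw [hi.pow_eq (by omega)] at hd
  have hrk : rk e = rk (s ^ N) := by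
    refine rk_eq_of_isNilpotent hi hsN (hnil _ ?_) (hnil _ ?_)
    · exact (hleft _ he _ (hleft _ he _ hd).1).2
    · have hd' := Submodule.neg_mem _ hd
      rw [neg_sub] at hd'
      exact (hleft _ (pow_mem hsE N) _ (hleft _ (pow_mem hsE N) _ hd').1).2
  rw [hs, ← map_pow] at hsN hrk
  have hS : Polynomial.aeval (φ a) (∏ l ∈ (P.map (algebraMap F L)).roots.toFinset,
      (Polynomial.X - Polynomial.C l)) = 0 := by
    rw [prod_X_sub_roots h1 h2, ← map_aeval_mapTup, h3', map_zero]
  obtain ⟨U, hU, hsum⟩ := exists_eq_sum_specProj hS hsN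
  rw [hrk, hsum, rk_sum U _ fun i hi' j hj => specProj_mul hS (hU hi') (hU hj)]
  exact AddSubmonoid.sum_mem _ fun l hl =>
    rk_specProj_mem_charKer hσ a.2 h1 h2 h3' h0 h5 (hU hl)

end Local

section Descent

variable {I Ω : Type} {src tgt : Ω → I} {F : Type} [Field F]

theorem IsPrim.exists_inverse {K : Type*} [Field K] {β : I → ℕ} {A : Subalgebra K (Tup K β)}
    {e : Tup K β} (he : IsPrim A e)
    (hpow : ∀ y : Tup K β, ∃ N : ℕ, 1 ≤ N ∧ IsIdempotentElem (y ^ N)) {f : Tup K β} (hf : f ∈ A) :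
    ∃ b, (b = f ∨ b = 1 - f) ∧ ∃ c ∈ A, c * e = c ∧ c * b * e = e := by
  have key : ∀ b ∈ A, IsNilpotent (e * b * e) ∨ ∃ c ∈ A, c * e = c ∧ c * b * e = e := by
    intro b hb
    obtain ⟨N, hN, hi⟩ := hpow (e * b * e)
    set y := e * b * e with hy
    have hyA : y ∈ A := mul_mem (mul_mem he.mem hb) he.mem
    have hey : e * y = y := by rw [hy, ← mul_assoc, ← mul_assoc, he.idem.eq]
    have hye : y * e = y := by rw [hy, mul_assoc, he.idem.eq]
    obtain ⟨M, rfl⟩ : ∃ M, N = M + 1 := ⟨N - 1, by omega⟩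
    rcases he.eq_of_le (y ^ (M + 1)) (pow_mem hyA _) hi
      (by rw [pow_succ', ← mul_assoc, hey]) (by rw [pow_succ, mul_assoc, hye]) with h | h
    · exact Or.inl ⟨_, h⟩
    · right
      refine ⟨y ^ (M + 1) * y ^ M * e, mul_mem (pow_mem hyA _ |> fun h => mul_mem h (pow_mem hyA _))
        he.mem, by rw [mul_assoc, he.idem.eq], ?_⟩
      calc y ^ (M + 1) * y ^ M * e * b * e = y ^ (M + 1) * (y ^ M * (e * b * e)) := by
            simp only [mul_assoc]
        _ = y ^ (M + 1) * y ^ (M + 1) := by rw [← hy, ← pow_succ]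
        _ = e := by rw [hi.eq, h]
  rcases key f hf with h1 | h1
  · rcases key (1 - f) (sub_mem (one_mem _) hf) with h2 | h2
    · exfalso
      have hsum : e * f * e + e * (1 - f) * e = e := by
        rw [← add_mul, ← mul_add, add_sub_cancel, mul_one, he.idem.eq]
      have hcomm : Commute (e * f * e) (e * (1 - f) * e) := by
        rw [← eq_sub_iff_add_eq'] at hsum
        rw [hsum]
        refine Commute.sub_right ?_ (Commute.refl _)
        change e * f * e * e = e * (e * f * e)
        rw [mul_assoc (e * f), he.idem.eq, ← mul_assoc, ← mul_assoc, he.idem.eq]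
      obtain ⟨N, hN⟩ := hcomm.isNilpotent_add h1 h2
      rw [hsum] at hN
      refine he.ne_zero ?_
      rcases N with _ | N
      · have h10 : (1 : Tup K β) = 0 := by simpa using hN
        rw [← mul_one e, h10, mul_zero]
      · rwa [he.idem.pow_succ_eq] at hN
    · exact ⟨_, Or.inr rfl, h2⟩
  · exact ⟨_, Or.inl rfl, h1⟩

variable [Fintype I]

theorem DetTrivial.of_retract {σ : I → (Fˣ →* ℂˣ)} {β γ : I → ℕ} {x : Rep src tgt F β}
    {y : Rep src tgt F γ} (hσ : DetTrivial src tgt σ x)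
    {i : ∀ v, Matrix (Fin (β v)) (Fin (γ v)) F} {p : ∀ v, Matrix (Fin (γ v)) (Fin (β v)) F}
    (hi : IsHom src tgt y x i) (hp : IsHom src tgt x y p) (h : ∀ v, p v * i v = 1) :
    DetTrivial src tgt σ y := by
  intro g hg d hd
  have h1 : (1 + ((fun v => i v * g v * p v) - fun v => i v * p v) : Tup F β)
      ∈ endAlg src tgt x :=
    add_mem (one_mem _) (sub_mem (mem_endAlg.2 ((hi.comp hg).comp hp)) (mem_endAlg.2 (hi.comp hp)))
  refine hσ _ h1 d fun v => ?_
  rw [← hd]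
  change (1 + (i v * g v * p v - i v * p v)).det = _
  rw [← Matrix.sub_mul, det_one_add_mul_comm, Matrix.mul_sub, ← Matrix.mul_assoc, h,
    Matrix.one_mul, add_sub_cancel]

variable [Finite F] {L : Type} [Field L] [Algebra F L] [IsAlgClosed L] [Normal F L]

/-- If the character is trivial on the automorphism group, then it is trivial on the dimension
vectors of the geometric summands. -/
theorem rk_mem_charKer {σ : I → (Fˣ →* ℂˣ)} {β : I → ℕ} {x : Rep src tgt F β}
    (hσ : DetTrivial src tgt σ x) {e : Tup L β}
    (he : IsPrim (endAlg src tgt (baseChange src tgt (algebraMap F L) x)) e) :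
    rk e ∈ charKer σ := by
  induction hN : ∑ v, β v using Nat.strong_induction_on generalizing β with
  | _ N ih =>
    have hβ : (1 : Tup F β) ≠ 0 := by
      intro h
      have := congrArg (mapTup (algebraMap F L) β) h
      rw [map_one, map_zero] at this
      exact he.ne_zero (by rw [← mul_one e, this, mul_zero])
    by_cases hx : ∀ f ∈ endAlg src tgt x, IsIdempotentElem f → f = 0 ∨ f = 1
    · exact rk_mem_charKer_of_local hβ hσ hx he.mem he.idem
    push Not at hx
    obtain ⟨f₀, hf₀, hfi₀, hf0, hf1⟩ := hx
    obtain ⟨b, hb, c, hc, hce, hcbe⟩ := he.exists_inverse (fun y =>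
      exists_pow_isIdempotentElem_tup (F := F) y) (mapTup_mem_endAlg (algebraMap F L) hf₀)
    obtain ⟨f, hf, hfi, hfne, rfl⟩ : ∃ f ∈ endAlg src tgt x, IsIdempotentElem f ∧ f ≠ 1 ∧
        b = mapTup (algebraMap F L) β f := by
      rcases hb with rfl | rfl
      · exact ⟨f₀, hf₀, hfi₀, hf1, rfl⟩
      · exact ⟨1 - f₀, sub_mem (one_mem _) hf₀, hfi₀.one_sub, fun h => hf0 (by simpa using h),
          by rw [map_sub, map_one]⟩
    obtain ⟨y, i, p, hi, hp, hip, hpi⟩ := exists_image hf hfi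
    have hlt : ∑ v, rk f v < N := by
      have h1 := rk_add hfi hfi.one_sub (by rw [mul_sub, mul_one, hfi.eq, sub_self])
        (by rw [sub_mul, one_mul, hfi.eq, sub_self])
      rw [add_sub_cancel] at h1
      have h2 : rk (1 : Tup F β) = β := by funext v; simp [rk]
      have h3 : ∑ v, β v = ∑ v, rk f v + ∑ v, rk (1 - f) v := by
        rw [← Finset.sum_add_distrib]
        exact Finset.sum_congr rfl fun v _ => congrFun (h2.symm.trans h1) v
      have h4 : ∑ v, rk (1 - f) v ≠ 0 := fun h0 => by
        rw [Finset.sum_eq_zero_iff] at h0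
        have h5 := (rk_eq_zero hfi.one_sub).1 (funext fun v => h0 v (Finset.mem_univ v))
        exact hfne (sub_eq_zero.1 h5).symm
      omega
    have hI := hi.map (algebraMap F L)
    have hP := hp.map (algebraMap F L)
    have hIP : ∀ v, (i v).map (algebraMap F L) * (p v).map (algebraMap F L)
        = mapTup (algebraMap F L) β f v := fun v => by
      rw [← Matrix.map_mul, hip, mapTup_apply]
    obtain ⟨h1, h2⟩ := he.transport (hP.comp he.mem) (IsHom.comp (mem_endAlg.1 hc) hI) (fun v => by
        calc _ = c v * ((i v).map (algebraMap F L) * (p v).map (algebraMap F L)) * e v := by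
              simp only [Matrix.mul_assoc]
          _ = e v := by rw [hIP]; exact congrFun hcbe v)
      (fun v => by rw [Matrix.mul_assoc]; congr 1; exact idem_apply he.idem v)
    rw [← h2]
    exact ih _ hlt (hσ.of_retract hi hp hpi) h1 rfl

end Descent

section Converse

theorem aeval_mem_of_mem {K A : Type*} [CommRing K] [Ring A] [Algebra K A] {B : Subalgebra K A}
    {a : A} (ha : a ∈ B) (p : Polynomial K) : Polynomial.aeval a p ∈ B := by
  have h : Polynomial.aeval a p = B.val (Polynomial.aeval ⟨a, ha⟩ p) :=
    Polynomial.aeval_algHom_apply B.val (⟨a, ha⟩ : B) p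
  exact h ▸ Subtype.mem _

variable {I Ω : Type} [Fintype I] {src tgt : Ω → I} {F : Type} [Field F]
  [Finite F] {L : Type} [Field L] [Algebra F L] [IsAlgClosed L] [Normal F L]

/-- The character is trivial on semisimple automorphisms. -/
theorem prod_det_eq_one_of_separable {σ : I → (Fˣ →* ℂˣ)} {β : I → ℕ} {x : Rep src tgt F β}
    (h : ∀ e ∈ endAlg src tgt (baseChange src tgt (algebraMap F L) x), IsIdempotentElem e →
      rk e ∈ charKer σ) {g : Tup F β} (hg : g ∈ endAlg src tgt x) {P : Polynomial F}
    (h1 : P.Monic) (h2 : P.Separable) (h0 : P.coeff 0 ≠ 0) (hP : Polynomial.aeval g P = 0)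
    {d : I → Fˣ} (hd : ∀ v, (g v).det = d v) : ∏ v, σ v (d v) = 1 := by
  set S := (P.map (algebraMap F L)).roots.toFinset with hSdef
  set a := mapTup (algebraMap F L) β g with ha
  have hS : Polynomial.aeval a (∏ l ∈ S, (Polynomial.X - Polynomial.C l)) = 0 := by
    rw [prod_X_sub_roots_of_separable h1 h2, ← map_aeval_mapTup, hP, map_zero]
  have hmem : ∀ {l : L}, l ∈ S ↔ Polynomial.aeval l P = 0 := mem_roots_toFinset_iff h1 _
  have key : ∀ μ ∈ S.image (minpoly F), ∃ δ ∈ charKer σ, ∃ u : Fˣ, ∀ v,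
      ∏ l ∈ S with minpoly F l = μ, l ^ rk (specProj a S l) v
        = algebraMap F L ((u : F) ^ δ v) := by
    intro μ hμ
    obtain ⟨m, hm, rfl⟩ := Finset.mem_image.1 hμ
    have hintegral : ∀ l : L, IsIntegral F l := fun l => Normal.isIntegral inferInstance l
    have hirr := minpoly.irreducible (hintegral m)
    have hmon := minpoly.monic (hintegral m)
    have hfil : (S.filter fun l => minpoly F l = minpoly F m)
        = ((minpoly F m).map (algebraMap F L)).roots.toFinset := by
      ext l
      rw [Finset.mem_filter, mem_roots_toFinset_iff hmon, hmem]
      constructor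
      · rintro ⟨-, h3⟩
        rw [← h3, minpoly.aeval]
      · intro h3
        refine ⟨?_, (minpoly.eq_of_irreducible_of_monic hirr h3 hmon).symm⟩
        obtain ⟨Q, hQ⟩ := minpoly.dvd F m (hmem.1 hm)
        rw [hQ, map_mul, h3, zero_mul]
    have hall : ∀ l ∈ S, minpoly F l = minpoly F m →
        rk (specProj a S l) = rk (specProj a S m) := by
      intro l hl hlm
      obtain ⟨f, hf⟩ := minpoly.exists_algEquiv_of_root' (x := l) (y := m)
        (hintegral m).isAlgebraic (by rw [← hlm, minpoly.aeval])
      rw [← hf]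
      refine rk_specProj_galois g hS f (fun k hk => ?_) hm
      rw [hmem] at hk ⊢
      exact (Polynomial.aeval_algHom_apply f.toAlgHom k P).trans (by rw [hk, map_zero])
    have hne : (-1) ^ (minpoly F m).natDegree * (minpoly F m).coeff 0 ≠ 0 := by
      refine mul_ne_zero (pow_ne_zero _ (neg_ne_zero.2 one_ne_zero)) fun h3 => ?_
      obtain ⟨Q, hQ⟩ := minpoly.dvd F m (hmem.1 hm)
      exact h0 (by rw [hQ, Polynomial.mul_coeff_zero, h3, zero_mul])
    have hE : specProj a S m ∈ endAlg src tgt (baseChange src tgt (algebraMap F L) x) :=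
      aeval_mem_of_mem (A := Tup L β) (a := a) (mapTup_mem_endAlg (algebraMap F L) hg)
        (Lagrange.basis S id m)
    refine ⟨rk (specProj a S m), h _ hE (isIdempotentElem_specProj hS hm),
      Units.mk0 _ hne, fun v => ?_⟩
    rw [Units.val_mk0, map_pow, ← prod_roots hmon hirr, ← hfil, ← Finset.prod_pow]
    refine Finset.prod_congr rfl fun l hl => ?_
    rw [Finset.mem_filter] at hl
    rw [hall l hl.1 hl.2]
  choose! δ hδ u hu using key
  have hdet : ∀ v, d v = ∏ μ ∈ S.image (minpoly F), u μ ^ δ μ v := by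
    intro v
    apply Units.ext
    apply (algebraMap F L).injective
    rw [Units.coe_prod, map_prod, ← hd, RingHom.map_det]
    refine (det_eq_prod_specProj hS v).trans ?_
    rw [← Finset.prod_fiberwise_of_maps_to (fun l hl => Finset.mem_image_of_mem (minpoly F) hl)]
    refine Finset.prod_congr rfl fun μ hμ => ?_
    rw [hu μ hμ v, Units.val_pow_eq_pow_val]
  calc ∏ v, σ v (d v) = ∏ μ ∈ S.image (minpoly F), ∏ v, σ v (u μ ^ δ μ v) := by
        rw [Finset.prod_comm]
        exact Finset.prod_congr rfl fun v _ => by rw [hdet v, map_prod]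
    _ = 1 := Finset.prod_eq_one fun μ hμ => by
        have h3 : ∏ v, σ v ^ δ μ v = 1 := hδ μ hμ
        rw [prod_pow_apply, h3]
        rfl

theorem detTrivial_of_rk_mem_charKer {σ : I → (Fˣ →* ℂˣ)} {β : I → ℕ} {x : Rep src tgt F β}
    (h : ∀ e ∈ endAlg src tgt (baseChange src tgt (algebraMap F L) x), IsIdempotentElem e →
      rk e ∈ charKer σ) : DetTrivial src tgt σ x := by
  intro g hg d hd
  have : Fintype F := Fintype.ofFinite F
  have : Finite (Tup F β) := by
    have : ∀ v, Finite (Matrix (Fin (β v)) (Fin (β v)) F) := fun v =>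
      inferInstanceAs (Finite (Fin (β v) → Fin (β v) → F))
    exact Pi.finite
  have hunit : IsUnit g := Pi.isUnit_iff.2 fun v => (Matrix.isUnit_iff_isUnit_det _).2
    (by rw [hd]; exact (d v).isUnit)
  obtain ⟨w, rfl⟩ := hunit
  obtain ⟨p, hp⟩ := CharP.exists F
  have hpp : Fact p.Prime := ⟨CharP.char_is_prime F p⟩
  obtain ⟨r, -, hr⟩ := FiniteField.card F p
  have ho : orderOf w ≠ 0 := (orderOf_pos w).ne'
  obtain ⟨M, N, hN, hw⟩ := Nat.exists_eq_pow_mul_and_not_dvd ho p hpp.out.ne_one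
  set Q := Fintype.card F ^ M with hQ
  have hQ1 : ∀ c : Fˣ, c ^ Q = c := by
    intro c
    apply Units.ext
    rw [Units.val_pow_eq_pow_val, hQ, FiniteField.pow_card_pow]
  have hNF : (N : F) ≠ 0 := fun h3 => hN ((CharP.cast_eq_zero_iff F p N).1 h3)
  have hN0 : 0 < N := Nat.pos_of_ne_zero fun h3 => hN (h3 ▸ dvd_zero p)
  have hwQ : (w ^ Q) ^ N = 1 := by
    rw [← pow_mul, ← orderOf_dvd_iff_pow_eq_one, hw]
    refine Nat.mul_dvd_mul_right ?_ N
    rw [hQ, hr, ← pow_mul]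
    exact pow_dvd_pow p (Nat.le_mul_of_pos_left M r.pos)
  have hwQ' : ((w : Tup F β) ^ Q) ^ N = 1 := by
    rw [← Units.val_pow_eq_pow_val, ← Units.val_pow_eq_pow_val, hwQ, Units.val_one]
  refine prod_det_eq_one_of_separable (P := Polynomial.X ^ N - 1) h (g := (w : Tup F β) ^ Q)
    (pow_mem (mem_endAlg.2 hg) _)
    (Polynomial.monic_X_pow_sub_C 1 hN0.ne') (Polynomial.X_pow_sub_one_separable_iff.2 hNF) ?_ ?_
    (fun v => ?_)
  · simp [Polynomial.coeff_X_pow, hN0.ne]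
  · simp [hwQ']
  · rw [Pi.pow_apply, Matrix.det_pow, hd, ← Units.val_pow_eq_pow_val, hQ1]

end Converse

section Legs

variable {k m : ℕ} {s : Fin k → ℕ}

/-- The distance of a vertex to the centre. -/
def depth : StarV k s → ℕ
  | none => 0
  | some a => a.2.1 + 1

theorem depth_some (a : (i : Fin k) × Fin (s i)) :
    depth (some a : StarV k s) = depth (legPrev k s a) + 1 := by
  unfold legPrev
  split_ifs with h
  · simp [depth, h]
  · simp only [depth]; omega

theorem legPrev_injOn {a b : (i : Fin k) × Fin (s i)} (h : legPrev k s a = legPrev k s b)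
    (h0 : legPrev k s a ≠ none) : a = b := by
  obtain ⟨i, j⟩ := a
  obtain ⟨i', j'⟩ := b
  unfold legPrev at h h0
  by_cases h1 : j.1 = 0
  · simp [h1] at h0
  by_cases h2 : j'.1 = 0
  · simp [h1, h2] at h
  rw [dif_neg h1, dif_neg h2] at h
  simp only [Option.some.injEq, Sigma.mk.injEq] at h
  obtain ⟨rfl, h3⟩ := h
  rw [heq_eq_eq, Fin.mk.injEq] at h3
  congr 1
  ext
  omega

theorem starV_induction {p : StarV k s → Prop} (h0 : p none)
    (h1 : ∀ a, p (legPrev k s a) → p (some a)) (v : StarV k s) : p v := by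
  induction hN : depth v generalizing v with
  | zero => cases v with
    | none => exact h0
    | some a => rw [depth_some] at hN; omega
  | succ N ih => cases v with
    | none => exact h0
    | some a => exact h1 a (ih _ (by rw [depth_some] at hN; omega))

variable {F : Type} [Field F] {β : StarV k s → ℕ}

/-- The map attached to an arrow of a leg. -/
def legMap (x : Rep (starSrc k m s) (starTgt k m s) F β) (a : (i : Fin k) × Fin (s i)) :
    Matrix (Fin (β (legPrev k s a))) (Fin (β (some a))) F := x (Sum.inr a)

/-- The map attached to a loop. -/
def loopMap (x : Rep (starSrc k m s) (starTgt k m s) F β) (r : Fin m) :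
    Matrix (Fin (β none)) (Fin (β none)) F := x (Sum.inl r)

theorem isHom_star_iff {γ : StarV k s → ℕ} {x : Rep (starSrc k m s) (starTgt k m s) F β}
    {y : Rep (starSrc k m s) (starTgt k m s) F γ}
    {u : ∀ v, Matrix (Fin (γ v)) (Fin (β v)) F} :
    IsHom (starSrc k m s) (starTgt k m s) x y u ↔
      (∀ r, u none * loopMap x r = loopMap y r * u none) ∧
      ∀ a, u (legPrev k s a) * legMap x a = legMap y a * u (some a) :=
  ⟨fun h => ⟨fun r => h (Sum.inl r), fun a => h (Sum.inr a)⟩, fun h a => by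
    rcases a with r | a
    · exact h.1 r
    · exact h.2 a⟩

/-- All leg maps are injective. -/
def LegInj (x : Rep (starSrc k m s) (starTgt k m s) F β) : Prop :=
  ∀ a, Function.Injective (legMap x a).mulVec

theorem exists_left_inverse {p q : ℕ} {X : Matrix (Fin p) (Fin q) F}
    (h : Function.Injective X.mulVec) : ∃ B : Matrix (Fin q) (Fin p) F, B * X = 1 := by
  obtain ⟨g, hg⟩ := LinearMap.exists_leftInverse_of_injective X.mulVecLin
    (LinearMap.ker_eq_bot.2 h)
  refine ⟨LinearMap.toMatrix' g, ?_⟩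
  have := congrArg LinearMap.toMatrix' hg
  rwa [LinearMap.toMatrix'_comp, LinearMap.toMatrix'_id, ← Matrix.toLin'_apply',
    LinearMap.toMatrix'_toLin'] at this

theorem isIdempotentElem_update {I : Type} [DecidableEq I] {β : I → ℕ} {e : Tup F β}
    (he : IsIdempotentElem e)
    {v : I} {u φ : Fin (β v) → F} (h : φ ⬝ᵥ u = 1) :
    IsIdempotentElem (Function.update e v (vecMulVec u φ)) := by
  funext w
  rw [Pi.mul_apply]
  by_cases hw : w = v
  · subst hw
    rw [Function.update_self, vecMulVec_mul_vecMulVec, h, one_smul]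
  · rw [Function.update_of_ne hw]
    exact idem_apply he w

theorem exists_dual_vanishing {p q : ℕ} (X : Matrix (Fin p) (Fin q) F) (u : Fin p → F)
    (hu : ∀ w, X *ᵥ w ≠ u) : ∃ φ : Fin p → F, φ ⬝ᵥ u = 1 ∧ φ ᵥ* X = 0 := by
  obtain ⟨f, hf, hf0⟩ := Submodule.exists_le_ker_of_notMem (p := LinearMap.range X.mulVecLin)
    (v := u) (by rintro ⟨w, hw⟩; exact hu w hw)
  have h : ∀ w, ((f u)⁻¹ • fun i => f (Pi.single i 1)) ⬝ᵥ w = (f u)⁻¹ * f w := by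
    intro w
    conv_rhs => rw [LinearMap.pi_apply_eq_sum_univ f w]
    rw [smul_dotProduct, smul_eq_mul, dotProduct]
    congr 1
    refine Finset.sum_congr rfl fun i _ => ?_
    rw [smul_eq_mul, mul_comm]
    congr 2
    ext j
    simp [Pi.single_apply, eq_comm]
  refine ⟨(f u)⁻¹ • fun i => f (Pi.single i 1), by rw [h, inv_mul_cancel₀ hf], ?_⟩
  refine dotProduct_eq_zero _ fun w => ?_
  rw [← Matrix.dotProduct_mulVec, h]
  have : f (X *ᵥ w) = 0 := hf0 ⟨w, rfl⟩
  rw [this, mul_zero]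

/-- In a representation with injective deep leg maps, a nonzero vector at a leg vertex `v` is
the image of an idempotent tuple that commutes with all arrows but the one leaving `v`. -/
theorem exists_idempotent_below (x : Rep (starSrc k m s) (starTgt k m s) F β) {v : StarV k s}
    (hv : v ≠ none)
    (hx : ∀ b, depth v < depth (some b : StarV k s) → Function.Injective (legMap x b).mulVec)
    {u : Fin (β v) → F} (hu : u ≠ 0) :
    ∃ e : Tup F β, IsIdempotentElem e ∧ (∀ w, depth w ≤ depth v → w ≠ v → e w = 0) ∧
      (∃ φ, e v = vecMulVec u φ ∧ φ ⬝ᵥ u = 1) ∧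
      ∀ b, some b ≠ v → e (legPrev k s b) * legMap x b = legMap x b * e (some b) := by
  obtain ⟨D, hD⟩ : ∃ D, ∀ w : StarV k s, depth w ≤ D :=
    ⟨Finset.univ.sup depth, fun w => Finset.le_sup (Finset.mem_univ w)⟩
  obtain ⟨N, hN⟩ : ∃ N, D < N + depth v := ⟨D + 1, by omega⟩
  induction N generalizing v with
  | zero => exact absurd (hD v) (by omega)
  | succ N ih =>
    have hterm : (∃ φ : Fin (β v) → F, φ ⬝ᵥ u = 1 ∧ ∀ b, legPrev k s b = v → 
        (Function.update (0 : Tup F β) v (vecMulVec u φ)) (legPrev k s b) * legMap x b = 0) →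
        ∃ e : Tup F β, IsIdempotentElem e ∧ (∀ w, depth w ≤ depth v → w ≠ v → e w = 0) ∧
          (∃ φ, e v = vecMulVec u φ ∧ φ ⬝ᵥ u = 1) ∧
          ∀ b, some b ≠ v → e (legPrev k s b) * legMap x b = legMap x b * e (some b) := by
      rintro ⟨φ, h1, h2⟩
      refine ⟨Function.update 0 v (vecMulVec u φ), ?_, fun w _ hw => Function.update_of_ne hw _ _,
        ⟨φ, Function.update_self _ _ _, h1⟩, fun b hb => ?_⟩
      · exact isIdempotentElem_update IsIdempotentElem.zero h1
      · rw [Function.update_of_ne hb]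
        refine Eq.trans ?_ (Matrix.mul_zero _).symm
        by_cases hbv : legPrev k s b = v
        · exact h2 b hbv
        · rw [Function.update_of_ne hbv]
          exact Matrix.zero_mul _
    by_cases hb : ∃ b, legPrev k s b = v
    · obtain ⟨b, rfl⟩ := hb
      by_cases hw : ∃ w, legMap x b *ᵥ w = u
      · obtain ⟨w, rfl⟩ := hw
        obtain ⟨e, he, he0, ⟨φ, hφ, hφw⟩, hcomm⟩ := ih (v := some b) (u := w) (by simp)
          (fun c hc => hx c (by rw [depth_some b] at hc; omega)) (by rintro rfl; exact hu (Matrix.mulVec_zero _))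
          (by rw [depth_some]; omega)
        obtain ⟨B, hB⟩ := exists_left_inverse (hx b (by rw [depth_some b]; omega))
        have hdot : (φ ᵥ* B) ⬝ᵥ (legMap x b *ᵥ w) = 1 := by
          rw [← Matrix.dotProduct_mulVec, Matrix.mulVec_mulVec, hB, Matrix.one_mulVec, hφw]
        refine ⟨Function.update e (legPrev k s b) (vecMulVec (legMap x b *ᵥ w) (φ ᵥ* B)),
          isIdempotentElem_update he hdot, fun t ht htv => ?_,
          ⟨_, Function.update_self _ _ _, hdot⟩,
          fun c hc => ?_⟩
        · rw [Function.update_of_ne htv]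
          exact he0 t (by rw [depth_some b]; omega) (by rintro rfl; rw [depth_some b] at ht; omega)
        · rw [Function.update_of_ne hc]
          by_cases hcb : c = b
          · subst hcb
            rw [Function.update_self, hφ, Matrix.vecMulVec_mul, Matrix.mul_vecMulVec,
              Matrix.vecMul_vecMul, hB, Matrix.vecMul_one]
          · rw [Function.update_of_ne fun h => hcb (legPrev_injOn h (h ▸ hv))]
            exact hcomm c fun h => hcb (Option.some.inj h)
      · obtain ⟨φ, h1, h2⟩ := exists_dual_vanishing _ _ (not_exists.1 hw)
        refine hterm ⟨φ, h1, fun c hc => ?_⟩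
        obtain rfl := legPrev_injOn hc (hc ▸ hv)
        rw [Function.update_self, Matrix.vecMulVec_mul, h2]
        ext i j
        simp [vecMulVec_apply]
    · obtain ⟨φ, h1, -⟩ := exists_dual_vanishing (0 : Matrix _ (Fin 0) F) u
        (fun w hw => hu (by rw [← hw, Matrix.zero_mulVec]))
      exact hterm ⟨φ, h1, fun c hc => absurd ⟨c, hc⟩ hb⟩

theorem legInj_of_nonIncr {x : Rep (starSrc k m s) (starTgt k m s) F β}
    (h : ∀ e ∈ endAlg _ _ x, IsIdempotentElem e → NonIncr k s (rk e)) : LegInj x := by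
  by_contra hx
  obtain ⟨a, ha, hmax⟩ := Set.exists_max_image {a | ¬ Function.Injective (legMap x a).mulVec}
    (fun a => depth (some a : StarV k s)) (Set.toFinite _) (not_forall.1 hx)
  obtain ⟨u, hu, hu0⟩ : ∃ u, legMap x a *ᵥ u = 0 ∧ u ≠ 0 := by
    by_contra! hcon
    exact ha ((injective_iff_map_eq_zero (legMap x a).mulVecLin).2 hcon)
  obtain ⟨e, he, he0, ⟨φ, hφ, hφu⟩, hcomm⟩ := exists_idempotent_below x (v := some a) (by simp)
    (fun b hb => by
      by_contra hbi
      exact absurd (hmax b hbi) (not_le.2 hb)) hu0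
  have hprev : e (legPrev k s a) = 0 := he0 _ (by rw [depth_some]; omega) (fun h => by
    have := congrArg depth h
    rw [depth_some] at this; omega)
  have hnone : e none = 0 := he0 _ (Nat.zero_le _) (by simp)
  have hmem : e ∈ endAlg _ _ x := by
    refine isHom_star_iff.2 ⟨fun r => by rw [hnone, Matrix.zero_mul, Matrix.mul_zero], fun b => ?_⟩
    · by_cases hb : b = a
      · subst hb
        rw [hprev, hφ, Matrix.zero_mul, Matrix.mul_vecMulVec, hu, Matrix.zero_vecMulVec]
      · exact hcomm b fun h => hb (Option.some.inj h)
  have h1 := h e hmem he a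
  have h2 : rk e (legPrev k s a) = 0 := by simp [rk, hprev]
  have h3 : (e (some a)).rank = 0 := by
    change rk e (some a) = 0
    omega
  have h4 : e (some a) *ᵥ u = u := by rw [hφ, Matrix.vecMulVec_mulVec, hφu]; simp
  rw [Matrix.rank, Submodule.finrank_eq_zero, LinearMap.range_eq_bot] at h3
  have h5 : e (some a) = 0 := Matrix.toLin'.injective (by rw [Matrix.toLin'_apply', h3, map_zero])
  rw [h5, Matrix.zero_mulVec] at h4
  exact hu0 h4.symm

theorem LegInj.nonIncr {x : Rep (starSrc k m s) (starTgt k m s) F β} (hx : LegInj x)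
    {e : Tup F β} (he : e ∈ endAlg _ _ x) : NonIncr k s (rk e) := by
  intro a
  obtain ⟨B, hB⟩ := exists_left_inverse (hx a)
  have h1 : e (legPrev k s a) * legMap x a = legMap x a * e (some a) := (isHom_star_iff.1 he).2 a
  calc (e (some a)).rank = (B * (legMap x a * e (some a))).rank := by
        rw [← Matrix.mul_assoc, hB, Matrix.one_mul]
    _ ≤ (legMap x a * e (some a)).rank := Matrix.rank_mul_le_right _ _
    _ = (e (legPrev k s a) * legMap x a).rank := by rw [h1]
    _ ≤ _ := Matrix.rank_mul_le_left _ _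

theorem LegInj.baseChange {L : Type} [Field L] (f : F →+* L)
    {x : Rep (starSrc k m s) (starTgt k m s) F β} (hx : LegInj x) :
    LegInj (QRep.baseChange _ _ f x) := by
  intro a
  obtain ⟨B, hB⟩ := exists_left_inverse (hx a)
  have h : B.map f * legMap (QRep.baseChange _ _ f x) a = 1 := by
    have := congrArg (fun X => X.map f) hB
    simp only [Matrix.map_mul] at this
    rw [Matrix.map_one f (map_zero f) (map_one f)] at this
    exact this
  intro w w' hw
  have := congrArg (fun t => B.map f *ᵥ t) hw
  simpa only [Matrix.mulVec_mulVec, h, Matrix.one_mulVec] using this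

end Legs

section Level

variable {k m : ℕ} {s : Fin k → ℕ} {F : Type} [Field F] [Fintype F]

/-- The submonoid of dimension vectors that are non-increasing along each leg. -/
def nonIncrSubmonoid (k : ℕ) (s : Fin k → ℕ) : AddSubmonoid (StarV k s → ℕ) where
  carrier := {δ | NonIncr k s δ}
  zero_mem' _ := le_rfl
  add_mem' ha hb a := add_le_add (ha a) (hb a)

theorem levelAtMost_iff {α : StarV k s → ℕ} (x : Rep (starSrc k m s) (starTgt k m s) F α)
    (σ : StarV k s → (Fˣ →* ℂˣ)) :
    LevelAtMost (starSrc k m s) (starTgt k m s) x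
      {δ | NonIncr k s δ ∧ δ ≠ 0 ∧ (∀ v, δ v ≤ α v) ∧ ∏ v, σ v ^ δ v = 1} ↔
    LegInj x ∧ DetTrivial (starSrc k m s) (starTgt k m s) σ x := by
  have : Normal F (AlgebraicClosure F) := IsAlgClosure.normal F _
  refine (summands_mem_iff _ _).trans ⟨fun h => ⟨?_, ?_⟩, fun ⟨h1, h2⟩ e he => ⟨?_, ?_, ?_, ?_⟩⟩
  · refine legInj_of_nonIncr fun e he hi => ?_
    have := rk_mem_of_prim _ (nonIncrSubmonoid k s) (fun e he => (h e he).1) _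
      (mapTup_mem_endAlg (algebraMap F (AlgebraicClosure F)) he) (hi.map _)
    rwa [rk_mapTup _ hi] at this
  · exact detTrivial_of_rk_mem_charKer (L := AlgebraicClosure F) fun e he hi =>
      rk_mem_of_prim _ (charKer σ) (fun e he => (h e he).2.2.2) e he hi
  · exact (h1.baseChange _).nonIncr he.mem
  · exact fun h => he.ne_zero ((rk_eq_zero he.idem).1 h)
  · exact fun v => Matrix.rank_le_width _
  · exact rk_mem_charKer h2 he

end Level

section Burnside

variable {G X : Type*} [Group G] [Fintype G] [Fintype X] [MulAction G X]

theorem sum_fixed_eq_card_quot (S : Set X) (hS : ∀ g : G, ∀ p ∈ S, g • p ∈ S) :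
    ∑ g : G, ∑ p : X, (if g • p = p then (if p ∈ S then (1 : ℂ) else 0) else 0) =
      Nat.card (Quot fun p q : S => ∃ g : G, g • p.1 = q.1) * Fintype.card G := by
  let Y : SubMulAction G X := ⟨S, fun g p hp => hS g p hp⟩
  have h := MulAction.sum_card_fixedBy_eq_card_orbits_mul_card_group G Y
  have hq : Nat.card (Quot fun p q : S => ∃ g : G, g • p.1 = q.1) =
      Fintype.card (Quotient (MulAction.orbitRel G Y)) := by
    rw [← Nat.card_eq_fintype_card]
    refine Nat.card_congr (Quot.congr (ra := fun p q : S => ∃ g : G, g • p.1 = q.1)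
      (rb := (MulAction.orbitRel G Y).r) (Equiv.refl S) fun p q => ?_)
    let p' : Y := p
    let q' : Y := q
    change _ ↔ p' ∈ MulAction.orbit G q'
    rw [MulAction.mem_orbit_symm, MulAction.mem_orbit_iff]
    exact exists_congr fun g => ⟨fun h => Subtype.ext h, fun h => congrArg Subtype.val h⟩
  rw [hq, ← Nat.cast_mul, ← h, Nat.cast_sum]
  refine Finset.sum_congr rfl fun g _ => ?_
  have : ∀ p : X, (if g • p = p then (if p ∈ S then (1 : ℂ) else 0) else 0) =
      if p ∈ {p | p ∈ S ∧ g • p = p} then 1 else 0 := by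
    intro p
    by_cases h1 : g • p = p <;> simp [h1]
  simp only [this, Finset.sum_boole]
  rw [← Fintype.card_subtype]
  congr 1
  refine Fintype.card_congr ⟨fun p => ⟨⟨p.1, p.2.1⟩, Subtype.ext p.2.2⟩,
    fun p => ⟨p.1.1, p.1.2, congrArg Subtype.val p.2⟩, fun _ => rfl, fun _ => rfl⟩

/-- Orbit counting for a family of linear characters of the stabilizers. -/
theorem sum_stabilizer_characters (θ : X → G → ℂ) (S : Set X)
    (h1 : ∀ p ∈ S, ∀ g : G, g • p = p → θ p g = 1)
    (h0 : ∀ p ∉ S, (∀ g : G, g • p = p → θ p g = 0) ∨ ∃ g₀ : G, g₀ • p = p ∧ θ p g₀ ≠ 1 ∧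
      ∀ g : G, g • p = p → θ p (g₀ * g) = θ p g₀ * θ p g)
    (hS : ∀ g : G, ∀ p ∈ S, g • p ∈ S) :
    ∑ g : G, ∑ p : X, (if g • p = p then θ p g else 0) =
      Nat.card (Quot fun p q : S => ∃ g : G, g • p.1 = q.1) * Fintype.card G := by
  rw [← sum_fixed_eq_card_quot S hS, Finset.sum_comm, Finset.sum_comm (γ := G)]
  refine Finset.sum_congr rfl fun p _ => ?_
  by_cases hp : p ∈ S
  · refine Finset.sum_congr rfl fun g _ => ?_
    split_ifs with h
    · exact h1 p hp g h
    · rfl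
  · simp only [hp, if_false, ite_self, Finset.sum_const_zero]
    rcases h0 p hp with h | ⟨g₀, hg, hne, hmul⟩
    · refine Finset.sum_eq_zero fun g _ => ?_
      split_ifs with h'
      · exact h g h'
      · rfl
    · have key : ∑ g : G, (if g • p = p then θ p g else 0) =
          θ p g₀ * ∑ g : G, (if g • p = p then θ p g else 0) := by
        rw [Finset.mul_sum, ← Equiv.sum_comp (Equiv.mulLeft g₀)]
        refine Finset.sum_congr rfl fun g _ => ?_
        have hiff : (g₀ * g) • p = p ↔ g • p = p := by
          rw [mul_smul]
          exact ⟨fun h => smul_left_cancel g₀ (h.trans hg.symm), fun h => by rw [h, hg]⟩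
        simp only [Equiv.coe_mulLeft, hiff]
        split_ifs with h'
        · exact hmul g h'
        · rw [mul_zero]
      have : (1 - θ p g₀) * ∑ g : G, (if g • p = p then θ p g else 0) = 0 := by
        rw [sub_mul, one_mul, ← key, sub_self]
      exact (mul_eq_zero.1 this).resolve_left (sub_ne_zero.2 hne.symm)

end Burnside

section DetOn

variable {F : Type} [Field F] {M : Type} [AddCommGroup M] [Module F M]

/-- The determinant of the restriction of `T` to a stable subspace `U`. -/
noncomputable def detOn (T : M →ₗ[F] M) (U : Submodule F M) : F :=
  if h : ∀ x ∈ U, T x ∈ U then LinearMap.det (T.restrict h) else 0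

theorem detOn_eq {T : M →ₗ[F] M} {U : Submodule F M} (h : ∀ x ∈ U, T x ∈ U) :
    detOn T U = LinearMap.det (T.restrict h) := dif_pos h

theorem detOn_comp {S T : M →ₗ[F] M} {U : Submodule F M} (hS : ∀ x ∈ U, S x ∈ U)
    (hT : ∀ x ∈ U, T x ∈ U) : detOn (S ∘ₗ T) U = detOn S U * detOn T U := by
  rw [detOn_eq hS, detOn_eq hT, detOn_eq (T := S ∘ₗ T) (fun x hx => hS (T x) (hT x hx)),
    ← LinearMap.det_comp]
  rfl

/-- The restriction to the image of an injective map `c` intertwining `g` and `T`. -/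
theorem detOn_range {N : Type} [AddCommGroup N] [Module F N] {T : M →ₗ[F] M} {c : N →ₗ[F] M}
    (hc : Function.Injective c) {g : N →ₗ[F] N} (h : T ∘ₗ c = c ∘ₗ g) :
    detOn T (LinearMap.range c) = LinearMap.det g := by
  have hs : ∀ x ∈ LinearMap.range c, T x ∈ LinearMap.range c := by
    rintro _ ⟨y, rfl⟩
    exact ⟨g y, (LinearMap.congr_fun h y).symm⟩
  rw [detOn_eq hs, ← LinearMap.det_conj g (LinearEquiv.ofInjective c hc)]
  congr 1
  refine LinearMap.ext fun x => ?_
  obtain ⟨y, rfl⟩ := (LinearEquiv.ofInjective c hc).surjective x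
  ext
  simpa using LinearMap.congr_fun h y

theorem detOn_top (T : M →ₗ[F] M) : detOn T ⊤ = LinearMap.det T := by
  have := detOn_range (T := T) (c := LinearMap.id) (g := T) Function.injective_id rfl
  rwa [LinearMap.range_id] at this

theorem detOn_ne_zero [Module.Finite F M] {T : M →ₗ[F] M} (hT : Function.Injective T)
    {U : Submodule F M} (h : ∀ x ∈ U, T x ∈ U) : detOn T U ≠ 0 := by
  rw [detOn_eq h]
  intro h0
  obtain ⟨x, hx, hx0⟩ := Submodule.exists_mem_ne_zero_of_ne_bot
    (LinearMap.bot_lt_ker_of_det_eq_zero h0).ne'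
  refine hx0 (Subtype.ext (hT ?_))
  exact (congrArg Subtype.val (LinearMap.mem_ker.1 hx)).trans (map_zero T).symm

theorem detOn_eq_mul_quotDet [Module.Finite F M] {T : M →ₗ[F] M} {W U : Submodule F M}
    (hUW : U ≤ W) (hW : ∀ x ∈ W, T x ∈ W) (hU : ∀ x ∈ U, T x ∈ U) :
    detOn T W = detOn T U * quotDet T W U := by
  have hq : ∀ x ∈ U.comap W.subtype, T.restrict hW x ∈ U.comap W.subtype := fun x hx => hU x.1 hx
  rw [detOn_eq hW, LinearMap.det_eq_det_mul_det (U.comap W.subtype) (T.restrict hW) hq, quotDet,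
    dif_pos ⟨hW, hU⟩, ← detOn_range (T := T) (g := (T.restrict hW).restrict hq)
      (c := W.subtype ∘ₗ (U.comap W.subtype).subtype)
      (Subtype.val_injective.comp Subtype.val_injective) rfl]
  congr 2
  rw [LinearMap.range_comp, Submodule.range_subtype, Submodule.map_comap_subtype,
    inf_eq_right.2 hUW]

theorem χap_units (χ : Fˣ →* ℂˣ) (d : Fˣ) : χap χ (d : F) = χ d := by
  rw [χap, dif_neg d.ne_zero, Units.mk0_val]

theorem χap_mul (χ : Fˣ →* ℂˣ) (a b : F) : χap χ (a * b) = χap χ a * χap χ b := by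
  by_cases ha : a = 0
  · simp [χap, ha]
  by_cases hb : b = 0
  · simp [χap, hb]
  rw [← Units.val_mk0 ha, ← Units.val_mk0 hb, ← Units.val_mul]
  rw [χap_units, χap_units, χap_units, map_mul, Units.val_mul]

end DetOn

section FlagSums

variable {F : Type} [Field F] {n : ℕ}

/-- The flag with prescribed terms `W 0, …, W (l - 1)` in positions `1, …, l`. -/
def padFlag {l : ℕ} (W : Fin l → Submodule F (Fin n → F)) : ℕ → Submodule F (Fin n → F)
  | 0 => ⊤
  | j + 1 => if h : j < l then W ⟨j, h⟩ else ⊥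

theorem padFlag_succ {l : ℕ} (W : Fin l → Submodule F (Fin n → F)) (j : Fin l) :
    padFlag W (j + 1) = W j := dif_pos j.2

/-- The conditions on a sequence of subspaces to be a flag of type `β`. -/
def IsFlag {l : ℕ} (β : ℕ → ℕ) (W : Fin l → Submodule F (Fin n → F)) : Prop :=
  ∀ j : Fin l, W j ≤ padFlag W j ∧ Module.finrank F (W j) = β (j + 1)

/-- Flags of type `β` that are stable under `T`. -/
def IsStableFlag {l : ℕ} (β : ℕ → ℕ) (T : (Fin n → F) →ₗ[F] (Fin n → F))
    (W : Fin l → Submodule F (Fin n → F)) : Prop :=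
  IsFlag β W ∧ ∀ j, ∀ x ∈ W j, T x ∈ W j

theorem prod_range_div {A B : Type*} [CommGroup A] [CommGroup B] (γ : ℕ → (A →* B)) (d : ℕ → A)
    (l : ℕ) : ∏ j ∈ Finset.range (l + 1), γ j (d j * (d (j + 1))⁻¹) =
      γ 0 (d 0) * (∏ j ∈ Finset.range l, (γ (j + 1) * (γ j)⁻¹) (d (j + 1))) *
        (γ l (d (l + 1)))⁻¹ := by
  induction l with
  | zero => simp
  | succ l ih =>
    rw [Finset.prod_range_succ, ih, Finset.prod_range_succ]
    simp only [map_mul, map_inv, MonoidHom.mul_apply, MonoidHom.inv_apply]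
    rw [mul_comm (γ (l + 1) (d (l + 1))) (γ l (d (l + 1)))⁻¹]
    simp only [mul_assoc]

theorem prod_quotDet {T : (Fin n → F) →ₗ[F] (Fin n → F)} (hT : Function.Injective T)
    {V : ℕ → Submodule F (Fin n → F)} (hV : ∀ j, V (j + 1) ≤ V j)
    (hs : ∀ j, ∀ x ∈ V j, T x ∈ V j) {l : ℕ} (hl : V (l + 1) = ⊥) (γ : ℕ → (Fˣ →* ℂˣ)) :
    ∏ j ∈ Finset.range (l + 1), χap (γ j) (quotDet T (V j) (V (j + 1))) =
      χap (γ 0) (detOn T (V 0)) *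
        ∏ j ∈ Finset.range l, χap (γ (j + 1) * (γ j)⁻¹) (detOn T (V (j + 1))) := by
  let d : ℕ → Fˣ := fun j => Units.mk0 _ (detOn_ne_zero hT (hs j))
  have hd : ∀ j, detOn T (V j) = d j := fun j => rfl
  have hq : ∀ j, quotDet T (V j) (V (j + 1)) = ((d j * (d (j + 1))⁻¹ : Fˣ) : F) := by
    intro j
    rw [Units.val_mul, ← hd, detOn_eq_mul_quotDet (hV j) (hs j) (hs (j + 1)), hd (j + 1), mul_comm,
      ← mul_assoc, Units.inv_mul, one_mul]
  have h1 : d (l + 1) = 1 := by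
    ext
    rw [← hd, hl, detOn_eq (by simp), Units.val_one]
    exact LinearMap.det_eq_one_of_subsingleton _
  simp only [hq, hd, χap_units]
  have := prod_range_div γ d l
  rw [h1, map_one, inv_one, mul_one] at this
  simpa using congrArg (Units.val) this

theorem HC_eq_sum [Fintype (Submodule F (Fin n → F))] {l : ℕ} {β : ℕ → ℕ} (h0 : β 0 = n)
    (hβ : ∀ j, l < j → β j = 0) (γ : ℕ → (Fˣ →* ℂˣ)) (g : GL (Fin n) F) :
    HC F n l β γ g = ∑ W : Fin l → Submodule F (Fin n → F),
      if IsStableFlag β (Matrix.mulVecLin g.1) W then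
        χap (γ 0) g.1.det *
          ∏ j : Fin l, χap (γ (j + 1) * (γ j)⁻¹) (detOn (Matrix.mulVecLin g.1) (W j))
      else 0 := by
  have hinj : Function.Injective (Matrix.mulVecLin g.1) :=
    Matrix.mulVec_injective_of_isUnit g.isUnit
  have hdet : LinearMap.det (Matrix.mulVecLin g.1) = g.1.det := LinearMap.det_toLin' g.1
  have hbot : ∀ V : ℕ → Submodule F (Fin n → F), (∀ j, Module.finrank F (V j) = β j) →
      ∀ j, l < j → V j = ⊥ := fun V hV j hj =>
    Submodule.finrank_eq_zero.1 ((hV j).trans (hβ j hj))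
  have hpad : ∀ V : ℕ → Submodule F (Fin n → F), V 0 = ⊤ →
      (∀ j, Module.finrank F (V j) = β j) → (padFlag fun j : Fin l => V (j + 1)) = V := by
    intro V hV0 hV
    funext j
    cases j with
    | zero => exact hV0.symm
    | succ j =>
      by_cases hj : j < l
      · exact dif_pos hj
      · exact (dif_neg hj).trans (hbot V hV _ (by omega)).symm
  let E : {V : ℕ → Submodule F (Fin n → F) //
      V 0 = ⊤ ∧ (∀ j, V (j + 1) ≤ V j) ∧ (∀ j, Module.finrank F (V j) = β j) ∧
      (∀ j, ∀ v ∈ V j, Matrix.mulVecLin (g : Matrix (Fin n) (Fin n) F) v ∈ V j)} ≃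
      {W : Fin l → Submodule F (Fin n → F) //
        IsStableFlag β (Matrix.mulVecLin g.1) W} :=
    { toFun := fun V => ⟨fun j => V.1 (j + 1), fun j => ⟨by
        rw [hpad V.1 V.2.1 V.2.2.2.1]; exact V.2.2.1 j, V.2.2.2.1 _⟩, fun j => V.2.2.2.2 _⟩
      invFun := fun W => ⟨padFlag W.1, rfl, by
          intro j
          by_cases hj : j < l
          · rw [padFlag_succ W.1 ⟨j, hj⟩]; exact (W.2.1 ⟨j, hj⟩).1
          · rw [padFlag, dif_neg hj]; exact bot_le, by
          intro j
          cases j with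
          | zero => rw [h0, padFlag, finrank_top, Module.finrank_fin_fun]
          | succ j =>
            by_cases hj : j < l
            · rw [padFlag_succ W.1 ⟨j, hj⟩]; exact (W.2.1 ⟨j, hj⟩).2
            · rw [padFlag, dif_neg hj, hβ _ (by omega), finrank_bot], by
          intro j
          cases j with
          | zero => exact fun _ _ => Submodule.mem_top
          | succ j =>
            by_cases hj : j < l
            · rw [padFlag_succ W.1 ⟨j, hj⟩]; exact W.2.2 ⟨j, hj⟩
            · rw [padFlag, dif_neg hj]
              simp⟩
      left_inv := fun V => Subtype.ext (hpad V.1 V.2.1 V.2.2.2.1)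
      right_inv := fun W => Subtype.ext (funext fun j => padFlag_succ W.1 j) }
  rw [HC, ← Finset.sum_filter, Finset.sum_subtype 
    (p := fun W => IsStableFlag β (Matrix.mulVecLin g.1) W) _
    (fun W => Finset.mem_filter_univ W), ← finsum_eq_sum_of_fintype,
    ← finsum_comp_equiv E]
  refine finsum_congr fun V => ?_
  rw [prod_quotDet hinj V.2.2.1 V.2.2.2.2 (hbot V.1 V.2.2.2.1 _ (Nat.lt_succ_self l)), V.2.1,
    detOn_top, hdet, Finset.prod_range]
  rfl

end FlagSums

section Config

variable (F : Type) [Field F] (k m n : ℕ) (s : Fin k → ℕ)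

/-- Matrices attached to the loops and subspaces attached to the leg vertices. -/
def Config : Type :=
  (Fin m → Matrix (Fin n) (Fin n) F) × (((i : Fin k) × Fin (s i)) → Submodule F (Fin n → F))

instance : MulAction (GL (Fin n) F) (Config F k m n s) where
  smul h p := (fun r => h.1 * p.1 r * h⁻¹.1, fun a => (p.2 a).map (Matrix.mulVecLin h.1))
  one_smul p := by
    refine Prod.ext (funext fun r => ?_) (funext fun a => ?_)
    · change (1 : GL (Fin n) F).1 * p.1 r * (1 : GL (Fin n) F)⁻¹.1 = _
      simp
    · change (p.2 a).map (Matrix.mulVecLin (1 : GL (Fin n) F).1) = _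
      rw [Units.val_one, Matrix.mulVecLin_one, Submodule.map_id]
  mul_smul h h' p := by
    refine Prod.ext (funext fun r => ?_) (funext fun a => ?_)
    · change (h * h').1 * p.1 r * (h * h')⁻¹.1 = h.1 * (h'.1 * p.1 r * h'⁻¹.1) * h⁻¹.1
      rw [_root_.mul_inv_rev, Units.val_mul, Units.val_mul]
      simp only [Matrix.mul_assoc]
    · change (p.2 a).map (Matrix.mulVecLin (h * h').1) = ((p.2 a).map _).map _
      rw [Units.val_mul, Matrix.mulVecLin_mul, Submodule.map_comp]

variable {F k m n s}

theorem Config.smul_fst (h : GL (Fin n) F) (p : Config F k m n s) (r : Fin m) :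
    (h • p).1 r = h.1 * p.1 r * h⁻¹.1 := rfl

/-- The subspace attached to a vertex. -/
def Config.sub (p : Config F k m n s) : StarV k s → Submodule F (Fin n → F)
  | none => ⊤
  | some a => p.2 a

theorem Config.sub_smul (h : GL (Fin n) F) (p : Config F k m n s) (v : StarV k s) :
    (h • p).sub v = (p.sub v).map (Matrix.mulVecLin h.1) := by
  cases v with
  | none =>
    change ⊤ = Submodule.map _ ⊤
    rw [Submodule.map_top, eq_comm, LinearMap.range_eq_top]
    exact Matrix.mulVec_surjective_iff_isUnit.2 h.isUnit
  | some a => rfl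

/-- The subspaces form flags with dimensions given by `α`. -/
def Config.IsFlagged (α : StarV k s → ℕ) (p : Config F k m n s) : Prop :=
  ∀ a, p.sub (some a) ≤ p.sub (legPrev k s a) ∧ Module.finrank F (p.sub (some a)) = α (some a)

theorem map_eq_iff_stable (h : GL (Fin n) F) (U : Submodule F (Fin n → F)) :
    U.map (Matrix.mulVecLin h.1) = U ↔ ∀ x ∈ U, Matrix.mulVecLin h.1 x ∈ U := by
  refine ⟨fun h => Submodule.map_le_iff_le_comap.1 h.le, fun hle =>
    Submodule.eq_of_le_of_finrank_eq (Submodule.map_le_iff_le_comap.2 hle) ?_⟩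
  exact (Submodule.equivMapOfInjective _ (Matrix.mulVec_injective_of_isUnit h.isUnit)
    U).finrank_eq.symm

theorem Config.smul_eq_iff (h : GL (Fin n) F) (p q : Config F k m n s) :
    h • p = q ↔ (∀ r, h.1 * p.1 r = q.1 r * h.1) ∧
      ∀ v, (p.sub v).map (Matrix.mulVecLin h.1) = q.sub v := by
  constructor
  · rintro rfl
    refine ⟨fun r => ?_, fun v => (Config.sub_smul h p v).symm⟩
    rw [Config.smul_fst, Matrix.mul_assoc, ← Units.val_mul, inv_mul_cancel, Units.val_one,
      Matrix.mul_one]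
  · rintro ⟨h1, h2⟩
    refine Prod.ext (funext fun r => ?_) (funext fun a => h2 (some a))
    rw [Config.smul_fst, h1, Matrix.mul_assoc, ← Units.val_mul, mul_inv_cancel, Units.val_one,
      Matrix.mul_one]

/-- The value of the linear character attached to a configuration. -/
noncomputable def Config.theta (σ : StarV k s → (Fˣ →* ℂˣ)) (α : StarV k s → ℕ)
    (p : Config F k m n s) (h : GL (Fin n) F) : ℂ :=
  if p.IsFlagged α then ∏ v, χap (σ v) (detOn (Matrix.mulVecLin h.1) (p.sub v)) else 0

end Config

section MultSum

variable {F : Type} [Field F] {k m n : ℕ} {s : Fin k → ℕ}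

/-- The configuration with given matrices and subspaces. -/
def Config.mk (A : Fin m → Matrix (Fin n) (Fin n) F)
    (U : ((i : Fin k) × Fin (s i)) → Submodule F (Fin n → F)) : Config F k m n s := (A, U)

theorem Config.smul_eq_self_iff (h : GL (Fin n) F) (p : Config F k m n s) :
    h • p = p ↔ (∀ r, h.1 * p.1 r = p.1 r * h.1) ∧
      ∀ v, ∀ x ∈ p.sub v, Matrix.mulVecLin h.1 x ∈ p.sub v := by
  rw [Config.smul_eq_iff]
  exact and_congr_right' (forall_congr' fun v => map_eq_iff_stable h _)

theorem padFlag_eq_sub (p : Config F k m n s) (a : (i : Fin k) × Fin (s i)) :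
    padFlag (fun j => p.2 ⟨a.1, j⟩) a.2 = p.sub (legPrev k s a) := by
  obtain ⟨i, ⟨j, hj⟩⟩ := a
  unfold legPrev
  cases j with
  | zero => rfl
  | succ j => exact dif_pos _

theorem Config.isFlagged_iff (nn : Fin k → ℕ → ℕ) (p : Config F k m n s) :
    p.IsFlagged (starα k n s nn) ↔ ∀ i, IsFlag (legβ k s nn i) fun j => p.2 ⟨i, j⟩ := by
  refine ⟨fun h i j => ?_, fun h a => ?_⟩
  · rw [padFlag_eq_sub p ⟨i, j⟩]
    exact h ⟨i, j⟩
  · have := h a.1 a.2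
    rw [padFlag_eq_sub p a] at this
    exact this

theorem prod_HC [Fintype F] [Fintype (Submodule F (Fin n → F))] {nn : Fin k → ℕ → ℕ}
    (hsum : ∀ i, legβ k s nn i 0 = n) (γ : Fin k → ℕ → (Fˣ →* ℂˣ)) (h : GL (Fin n) F)
    (A : Fin m → Matrix (Fin n) (Fin n) F) :
    ∏ i, HC F n (s i) (legβ k s nn i) (γ i) h =
      ∑ U : ((i : Fin k) × Fin (s i)) → Submodule F (Fin n → F),
        if ∀ a, ∀ x ∈ U a, Matrix.mulVecLin h.1 x ∈ U a then
          Config.theta (starσ F k s γ) (starα k n s nn) (Config.mk A U) h else 0 := by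
  have hβ : ∀ i, ∀ j, s i < j → legβ k s nn i j = 0 := fun i j hj => by
    rw [legβ, Finset.Icc_eq_empty (not_le.2 hj), Finset.sum_empty]
  have hdet : LinearMap.det (Matrix.mulVecLin h.1) = h.1.det := LinearMap.det_toLin' h.1
  simp only [HC_eq_sum (hsum _) (hβ _)]
  rw [Finset.prod_univ_sum, Fintype.piFinset_univ, ← Equiv.sum_comp (Equiv.piCurry _)]
  refine Finset.sum_congr rfl fun U _ => ?_
  rw [Finset.prod_ite_zero, Config.theta, Config.isFlagged_iff, ← ite_and]
  have hiff : (∀ i ∈ Finset.univ, IsStableFlag (legβ k s nn i) (Matrix.mulVecLin h.1)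
      fun j => U ⟨i, j⟩) ↔
      (∀ a, ∀ x ∈ U a, Matrix.mulVecLin h.1 x ∈ U a) ∧
        ∀ i, IsFlag (legβ k s nn i) fun j => U ⟨i, j⟩ :=
    ⟨fun H => ⟨fun a => (H a.1 (Finset.mem_univ _)).2 a.2, fun i => (H i (Finset.mem_univ _)).1⟩,
      fun H i _ => ⟨H.2 i, fun j => H.1 ⟨i, j⟩⟩⟩
  by_cases hc : ∀ i ∈ Finset.univ, IsStableFlag (legβ k s nn i) (Matrix.mulVecLin h.1)
      fun j => U ⟨i, j⟩
  · refine (if_pos hc).trans (Eq.trans ?_ (if_pos (hiff.1 hc)).symm)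
    rw [Fintype.prod_option, Finset.prod_mul_distrib, ← Finset.univ_sigma_univ, Finset.prod_sigma]
    congr 1
    change _ = χap (∏ i, γ i 0) (detOn (Matrix.mulVecLin h.1) ⊤)
    rw [detOn_top, hdet]
    have hu : h.1.det = ((Matrix.GeneralLinearGroup.det h : Fˣ) : F) := rfl
    simp only [hu, χap_units, MonoidHom.finsetProd_apply, Units.coe_prod]
  · exact (if_neg hc).trans (if_neg fun H => hc (hiff.2 H)).symm

theorem mult_eq_sum [Fintype F] [Fintype (Config F k m n s)] {nn : Fin k → ℕ → ℕ}
    (hsum : ∀ i, legβ k s nn i 0 = n) (γ : Fin k → ℕ → (Fˣ →* ℂˣ)) :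
    mult F k m n s nn γ = (Fintype.card (GL (Fin n) F) : ℂ)⁻¹ *
      ∑ h : GL (Fin n) F, ∑ p : Config F k m n s,
        if h • p = p then p.theta (starσ F k s γ) (starα k n s nn) h else 0 := by
  have : Fintype (Submodule F (Fin n → F)) := Fintype.ofFinite _
  rw [mult, Nat.card_eq_fintype_card, finsum_eq_sum_of_fintype]
  congr 1
  refine Finset.sum_congr rfl fun h _ => ?_
  rw [Λcount, Nat.card_eq_fintype_card, Fintype.card_subtype, ← Finset.sum_boole, Finset.sum_mul]
  let E : (Fin m → Matrix (Fin n) (Fin n) F) ×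
      (((i : Fin k) × Fin (s i)) → Submodule F (Fin n → F)) ≃ Config F k m n s := Equiv.refl _
  rw [← Equiv.sum_comp E, Fintype.sum_prod_type]
  refine Finset.sum_congr rfl fun A _ => ?_
  rw [prod_HC hsum γ h A, Finset.mul_sum]
  refine Finset.sum_congr rfl fun U _ => ?_
  rw [ite_mul, one_mul, zero_mul, ← ite_and]
  refine if_congr
    ((Config.smul_eq_self_iff h (Config.mk A U)).trans (and_congr_right' ?_)).symm rfl rfl
  exact ⟨fun H a => H (some a), fun H v => by
    cases v with
    | none => exact fun _ _ => Submodule.mem_top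
    | some a => exact H a⟩

end MultSum

section Frames

variable {F : Type} [Field F] {k m : ℕ} {s : Fin k → ℕ} {α : StarV k s → ℕ}

theorem exists_mul_eq_of_range_le {p q r : ℕ} {X : Matrix (Fin p) (Fin q) F}
    {Y : Matrix (Fin p) (Fin r) F}
    (h : LinearMap.range X.mulVecLin ≤ LinearMap.range Y.mulVecLin) :
    ∃ u : Matrix (Fin r) (Fin q) F, Y * u = X := by
  choose w hw using fun j => h ⟨Pi.single j 1, rfl⟩
  refine ⟨Matrix.of fun i j => w j i, ?_⟩
  ext i j
  have := congrFun (hw j) i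
  rw [Matrix.mulVecLin_apply, Matrix.mulVecLin_apply, Matrix.mulVec_single_one] at this
  exact this

theorem isUnit_of_mulVec_injective {p : ℕ} {X : Matrix (Fin p) (Fin p) F}
    (h : Function.Injective X.mulVec) : IsUnit X :=
  Matrix.mulVec_injective_iff_isUnit.1 h

theorem mul_left_cancel_of_injective {p q r : ℕ} {C : Matrix (Fin p) (Fin q) F}
    (hC : Function.Injective C.mulVec) {X Y : Matrix (Fin q) (Fin r) F} (h : C * X = C * Y) :
    X = Y := by
  obtain ⟨B, hB⟩ := exists_left_inverse hC
  rw [← Matrix.one_mul X, ← hB, Matrix.mul_assoc, h, ← Matrix.mul_assoc, hB, Matrix.one_mul]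

/-- The composition of the maps along a leg from a vertex to the centre. -/
def frame (x : Rep (starSrc k m s) (starTgt k m s) F α) :
    ∀ v, Matrix (Fin (α none)) (Fin (α v)) F
  | none => 1
  | some a => frame x (legPrev k s a) * legMap x a
termination_by v => depth v
decreasing_by rw [depth_some]; exact Nat.lt_succ_self _

theorem frame_none (x : Rep (starSrc k m s) (starTgt k m s) F α) : frame x none = 1 := by
  rw [frame]

theorem frame_some (x : Rep (starSrc k m s) (starTgt k m s) F α) (a : (i : Fin k) × Fin (s i)) :
    frame x (some a) = frame x (legPrev k s a) * legMap x a := by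
  rw [frame]

theorem LegInj.frame_injective {x : Rep (starSrc k m s) (starTgt k m s) F α} (hx : LegInj x)
    (v : StarV k s) : Function.Injective (frame x v).mulVec := by
  refine starV_induction (p := fun v => Function.Injective (frame x v).mulVec) ?_
    (fun a ih => ?_) v
  · rw [frame_none]
    intro w w' h
    simpa using h
  · intro w w' h
    rw [frame_some, ← Matrix.mulVec_mulVec, ← Matrix.mulVec_mulVec] at h
    exact hx a (ih h)

/-- The loop matrices and leg images of a representation. -/
def toConfig (x : Rep (starSrc k m s) (starTgt k m s) F α) : Config F k m (α none) s :=
  Config.mk (loopMap x) fun a => LinearMap.range (frame x (some a)).mulVecLin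

theorem toConfig_sub (x : Rep (starSrc k m s) (starTgt k m s) F α) (v : StarV k s) :
    (toConfig x).sub v = LinearMap.range (frame x v).mulVecLin := by
  cases v with
  | none => rw [frame_none, Matrix.mulVecLin_one, LinearMap.range_id]; rfl
  | some a => rfl

theorem LegInj.isFlagged {x : Rep (starSrc k m s) (starTgt k m s) F α} (hx : LegInj x) :
    (toConfig x).IsFlagged α := by
  intro a
  rw [toConfig_sub, toConfig_sub]
  constructor
  · rw [frame_some, Matrix.mulVecLin_mul]
    exact LinearMap.range_comp_le_range _ _
  · rw [LinearMap.finrank_range_of_inj (hx.frame_injective _), Module.finrank_fin_fun]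

theorem glAct_eq_iff {I Ω : Type} {src tgt : Ω → I} {β : I → ℕ} (g : ∀ i, GL (Fin (β i)) F)
    (x y : Rep src tgt F β) :
    glAct src tgt g x = y ↔ IsHom src tgt x y fun v => (g v).1 := by
  refine funext_iff.trans (forall_congr' fun a => ?_)
  constructor
  · intro h
    rw [← h, glAct, Matrix.mul_assoc, ← Units.val_mul, inv_mul_cancel, Units.val_one,
      Matrix.mul_one]
  · intro h
    have h : (g (tgt a)).1 * x a = y a * (g (src a)).1 := h
    rw [glAct, h, Matrix.mul_assoc, ← Units.val_mul, mul_inv_cancel, Units.val_one,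
      Matrix.mul_one]

theorem frame_mul_of_isHom {x y : Rep (starSrc k m s) (starTgt k m s) F α}
    {g : ∀ v, Matrix (Fin (α v)) (Fin (α v)) F}
    (h : IsHom (starSrc k m s) (starTgt k m s) x y g) (v : StarV k s) :
    frame y v * g v = g none * frame x v := by
  refine starV_induction (p := fun v => frame y v * g v = g none * frame x v) ?_
    (fun a ih => ?_) v
  · rw [frame_none, frame_none, Matrix.mul_one, Matrix.one_mul]
  · rw [frame_some, frame_some, Matrix.mul_assoc, ← (isHom_star_iff.1 h).2 a, ← Matrix.mul_assoc,
      ih, Matrix.mul_assoc]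

theorem smul_toConfig_eq_iff {x y : Rep (starSrc k m s) (starTgt k m s) F α} (hx : LegInj x)
    (hy : LegInj y) (h : GL (Fin (α none)) F) :
    h • toConfig x = toConfig y ↔
      ∃ g : ∀ v, GL (Fin (α v)) F, g none = h ∧ glAct (starSrc k m s) (starTgt k m s) g x = y := by
  have hmap : ∀ v, ((toConfig x).sub v).map (Matrix.mulVecLin h.1) =
      LinearMap.range (h.1 * frame x v).mulVecLin := fun v => by
    rw [toConfig_sub, Matrix.mulVecLin_mul, LinearMap.range_comp]
  rw [Config.smul_eq_iff]
  constructor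
  · rintro ⟨h1, h2⟩
    choose u hu using fun v => exists_mul_eq_of_range_le
      ((hmap v).symm.trans ((h2 v).trans (toConfig_sub y v))).le
    have hinj : ∀ v, Function.Injective (u v).mulVec := fun v w w' hw =>
      hx.frame_injective v (Matrix.mulVec_injective_of_isUnit h.isUnit (by
        rw [Matrix.mulVec_mulVec, Matrix.mulVec_mulVec, ← hu, ← Matrix.mulVec_mulVec,
          ← Matrix.mulVec_mulVec, hw]))
    have hnone : u none = h.1 := by
      have := hu none
      rwa [frame_none, frame_none, Matrix.mul_one, Matrix.one_mul] at this
    refine ⟨fun v => (isUnit_of_mulVec_injective (hinj v)).unit, Units.ext hnone,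
      (glAct_eq_iff _ _ _).2 (isHom_star_iff.2 ⟨fun r => ?_, fun a => ?_⟩)⟩
    · change u none * _ = _ * u none
      rw [hnone]
      exact h1 r
    · refine mul_left_cancel_of_injective (hy.frame_injective (legPrev k s a)) ?_
      change _ * (u _ * _) = _ * (_ * u _)
      rw [← Matrix.mul_assoc, hu, Matrix.mul_assoc, ← frame_some, ← Matrix.mul_assoc,
        ← frame_some, hu]
  · rintro ⟨g, rfl, hg⟩
    have hhom := (glAct_eq_iff _ _ _).1 hg
    refine ⟨(isHom_star_iff.1 hhom).1, fun v => ?_⟩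
    rw [hmap, ← frame_mul_of_isHom hhom v, toConfig_sub, Matrix.mulVecLin_mul,
      LinearMap.range_comp_of_range_eq_top]
    exact LinearMap.range_eq_top.2 (Matrix.mulVec_surjective_iff_isUnit.2 (g v).isUnit)

theorem exists_toConfig_eq {p : Config F k m (α none) s} (hp : p.IsFlagged α) :
    ∃ x : Rep (starSrc k m s) (starTgt k m s) F α, LegInj x ∧ toConfig x = p := by
  have hrank : ∀ v, Module.finrank F (p.sub v) = α v := fun v => by
    cases v with
    | none => exact (finrank_top F _).trans (Module.finrank_fin_fun F)
    | some a => exact (hp a).2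
  have hc : ∀ v, ∃ c : Matrix (Fin (α none)) (Fin (α v)) F, Function.Injective c.mulVec ∧
      LinearMap.range c.mulVecLin = p.sub v := fun v => by
    have e : (Fin (α v) → F) ≃ₗ[F] p.sub v := LinearEquiv.ofFinrankEq _ _ (by
      rw [Module.finrank_fin_fun, hrank])
    refine ⟨LinearMap.toMatrix' ((p.sub v).subtype ∘ₗ e.toLinearMap), ?_, ?_⟩
    · intro w w' h
      rw [LinearMap.toMatrix'_mulVec, LinearMap.toMatrix'_mulVec] at h
      exact e.injective (Subtype.val_injective h)
    · rw [← Matrix.toLin'_apply', Matrix.toLin'_toMatrix', LinearMap.range_comp,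
        LinearEquiv.range, Submodule.map_top, Submodule.range_subtype]
  choose c hci hcr using hc
  let c' : ∀ v, Matrix (Fin (α none)) (Fin (α v)) F
    | none => 1
    | some a => c (some a)
  have hci' : ∀ v, Function.Injective (c' v).mulVec := fun v => by
    cases v with
    | none => intro w w' h; simpa [c'] using h
    | some a => exact hci (some a)
  have hcr' : ∀ v, LinearMap.range (c' v).mulVecLin = p.sub v := fun v => by
    cases v with
    | none => exact (congrArg LinearMap.range Matrix.mulVecLin_one).trans LinearMap.range_id
    | some a => exact hcr (some a)
  choose X hX using fun a => exists_mul_eq_of_range_le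
    ((hcr' (some a)).le.trans ((hp a).1.trans (hcr' (legPrev k s a)).ge))
  let x : Rep (starSrc k m s) (starTgt k m s) F α
    | Sum.inl r => p.1 r
    | Sum.inr a => X a
  have hframe : ∀ v, frame x v = c' v := fun v => by
    refine starV_induction (p := fun v => frame x v = c' v) (frame_none x) (fun a ih => ?_) v
    rw [frame_some, ih]
    exact hX a
  refine ⟨x, fun a w w' h => hci' (some a) ?_, Prod.ext rfl (funext fun a => ?_)⟩
  · rw [← hX, ← Matrix.mulVec_mulVec, ← Matrix.mulVec_mulVec]
    exact congrArg _ h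
  · change LinearMap.range (frame x (some a)).mulVecLin = p.sub (some a)
    rw [hframe, hcr']

theorem theta_toConfig {x : Rep (starSrc k m s) (starTgt k m s) F α} (hx : LegInj x)
    (σ : StarV k s → (Fˣ →* ℂˣ)) {g : ∀ v, GL (Fin (α v)) F}
    (hg : IsHom (starSrc k m s) (starTgt k m s) x x fun v => (g v).1) :
    (toConfig x).theta σ α (g none) =
      ((∏ v, σ v (Matrix.GeneralLinearGroup.det (g v)) : ℂˣ) : ℂ) := by
  rw [Config.theta, if_pos hx.isFlagged, Units.coe_prod]
  refine Finset.prod_congr rfl fun v _ => ?_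
  rw [← χap_units, toConfig_sub, detOn_range (hx.frame_injective v) (g := (g v).1.mulVecLin)]
  · exact congrArg _ (LinearMap.det_toLin' _)
  · rw [← Matrix.mulVecLin_mul, ← Matrix.mulVecLin_mul, frame_mul_of_isHom hg]

theorem detTrivial_iff_theta {x : Rep (starSrc k m s) (starTgt k m s) F α} (hx : LegInj x)
    (σ : StarV k s → (Fˣ →* ℂˣ)) :
    DetTrivial (starSrc k m s) (starTgt k m s) σ x ↔
      ∀ h : GL (Fin (α none)) F, h • toConfig x = toConfig x → (toConfig x).theta σ α h = 1 := by
  constructor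
  · intro H h hh
    obtain ⟨g, rfl, hg⟩ := (smul_toConfig_eq_iff hx hx h).1 hh
    have hg' := (glAct_eq_iff _ _ _).1 hg
    rw [theta_toConfig hx σ hg', H _ hg' (fun v => Matrix.GeneralLinearGroup.det (g v))
      fun v => rfl, Units.val_one]
  · intro H g hg d hd
    have hu : ∀ v, IsUnit (g v) := fun v =>
      (Matrix.isUnit_iff_isUnit_det _).2 (hd v ▸ (d v).isUnit)
    let g' : ∀ v, GL (Fin (α v)) F := fun v => (hu v).unit
    have hd' : ∀ v, Matrix.GeneralLinearGroup.det (g' v) = d v := fun v => Units.ext (hd v)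
    have h1 := H (g' none) ((smul_toConfig_eq_iff hx hx _).2
      ⟨g', rfl, (glAct_eq_iff _ _ _).2 hg⟩)
    rw [theta_toConfig hx σ (g := g') hg] at h1
    simp only [hd'] at h1
    exact Units.ext h1

theorem theta_mul (σ : StarV k s → (Fˣ →* ℂˣ)) {p : Config F k m (α none) s}
    (hp : p.IsFlagged α) {g h : GL (Fin (α none)) F} (hg : g • p = p) (hh : h • p = p) :
    p.theta σ α (g * h) = p.theta σ α g * p.theta σ α h := by
  rw [Config.theta, Config.theta, Config.theta, if_pos hp, if_pos hp, if_pos hp,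
    ← Finset.prod_mul_distrib]
  refine Finset.prod_congr rfl fun v _ => ?_
  rw [← χap_mul, ← detOn_comp (((Config.smul_eq_self_iff _ _).1 hg).2 v)
    (((Config.smul_eq_self_iff _ _).1 hh).2 v), ← Matrix.mulVecLin_mul, ← Units.val_mul]

end Frames

section Orbits

theorem card_quot_eq {A B : Type*} {r : A → A → Prop} {r' : B → B → Prop} (hr' : Equivalence r')
    (f : A → B) (hf : Function.Surjective f) (h : ∀ a b, r a b ↔ r' (f a) (f b)) :
    Nat.card (Quot r) = Nat.card (Quot r') := by
  refine Nat.card_eq_of_bijective (Quot.map f fun a b => (h a b).1) ⟨?_, ?_⟩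
  · rintro ⟨a⟩ ⟨b⟩ hab
    exact Quot.sound ((h a b).2 (hr'.eqvGen_iff.1 (Quot.eqvGen_exact hab)))
  · rintro ⟨b⟩
    obtain ⟨a, rfl⟩ := hf b
    exact ⟨Quot.mk _ a, rfl⟩

theorem equivalence_smul {G X : Type*} [Group G] [MulAction G X] (S : Set X) :
    Equivalence fun p q : S => ∃ g : G, g • p.1 = q.1 where
  refl p := ⟨1, one_smul _ _⟩
  symm := fun ⟨g, hg⟩ => ⟨g⁻¹, by rw [← hg, inv_smul_smul]⟩
  trans := fun ⟨g, hg⟩ ⟨h, hh⟩ => ⟨h * g, by rw [mul_smul, hg, hh]⟩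

variable {F : Type} [Field F] {k m : ℕ} {s : Fin k → ℕ} {α : StarV k s → ℕ}

theorem sum_theta_eq [Fintype F] [Fintype (Config F k m (α none) s)]
    (σ : StarV k s → (Fˣ →* ℂˣ)) :
    ∑ h : GL (Fin (α none)) F, ∑ p : Config F k m (α none) s,
      (if h • p = p then p.theta σ α h else 0) =
    (orbitCount (starSrc k m s) (starTgt k m s) α
      (fun x : Rep (starSrc k m s) (starTgt k m s) F α =>
        LegInj x ∧ DetTrivial (starSrc k m s) (starTgt k m s) σ x) : ℂ) *
      Fintype.card (GL (Fin (α none)) F) := by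
  let P := fun x : Rep (starSrc k m s) (starTgt k m s) F α =>
    LegInj x ∧ DetTrivial (starSrc k m s) (starTgt k m s) σ x
  have hP : ∀ x, P x ↔ LegInj x ∧ ∀ h : GL (Fin (α none)) F, h • toConfig x = toConfig x →
      (toConfig x).theta σ α h = 1 := fun x =>
    ⟨fun h => ⟨h.1, (detTrivial_iff_theta h.1 σ).1 h.2⟩,
      fun h => ⟨h.1, (detTrivial_iff_theta h.1 σ).2 h.2⟩⟩
  rw [sum_stabilizer_characters (fun p h => p.theta σ α h) {p | ∃ x, P x ∧ toConfig x = p}]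
  · congr 2
    refine (card_quot_eq (equivalence_smul _)
      (fun x : {x // P x} => (⟨toConfig x.1, x.1, x.2, rfl⟩ :
        {p | ∃ x, P x ∧ toConfig x = p})) ?_ fun x y => ?_).symm
    · rintro ⟨_, x, hx, rfl⟩
      exact ⟨⟨x, hx⟩, rfl⟩
    · constructor
      · rintro ⟨g, hg⟩
        exact ⟨g none, (smul_toConfig_eq_iff x.2.1 y.2.1 _).2 ⟨g, rfl, hg⟩⟩
      · rintro ⟨h, hh⟩
        obtain ⟨g, -, hg⟩ := (smul_toConfig_eq_iff x.2.1 y.2.1 _).1 hh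
        exact ⟨g, hg⟩
  · rintro _ ⟨x, hx, rfl⟩ h hh
    exact ((hP x).1 hx).2 h hh
  · intro p hp
    by_cases hf : p.IsFlagged α
    · right
      obtain ⟨x, hx, rfl⟩ := exists_toConfig_eq hf
      have hn : ¬ ∀ h : GL (Fin (α none)) F, h • toConfig x = toConfig x →
          (toConfig x).theta σ α h = 1 := fun H => hp ⟨x, (hP x).2 ⟨hx, H⟩, rfl⟩
      push Not at hn
      obtain ⟨g₀, h1, h2⟩ := hn
      exact ⟨g₀, h1, h2, fun g hg => theta_mul σ hf h1 hg⟩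
    · left
      exact fun g _ => if_neg hf
  · rintro h _ ⟨x, hx, rfl⟩
    let g : ∀ v, GL (Fin (α v)) F := Function.update 1 none h
    have hg : g none = h := Function.update_self _ _ _
    let y := glAct (starSrc k m s) (starTgt k m s) g x
    have hxy := (glAct_eq_iff g x y).1 rfl
    have h1 : ∀ v, (g v)⁻¹.1 * (g v).1 = 1 := fun v => by
      rw [← Units.val_mul, inv_mul_cancel, Units.val_one]
    have h2 : ∀ v, (g v).1 * (g v)⁻¹.1 = 1 := fun v => by
      rw [← Units.val_mul, mul_inv_cancel, Units.val_one]
    have hyx : IsHom (starSrc k m s) (starTgt k m s) y x fun v => (g v)⁻¹.1 :=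
      isHom_inv hxy h2 h1
    have hy : LegInj y := fun a w w' hw => by
      have hc := (isHom_star_iff.1 hyx).2 a
      have hw' := congrArg (fun t => (g (legPrev k s a))⁻¹.1 *ᵥ t) hw
      simp only [Matrix.mulVec_mulVec, hc] at hw'
      rw [← Matrix.mulVec_mulVec, ← Matrix.mulVec_mulVec] at hw'
      exact Matrix.mulVec_injective_of_isUnit ((g (some a))⁻¹).isUnit (hx.1 a hw')
    exact ⟨y, ⟨hy, hx.2.of_retract hyx hxy h2⟩,
      ((smul_toConfig_eq_iff hx.1 hy h).2 ⟨g, hg, rfl⟩).symm⟩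

end Orbits

end QRep

open QRep in
/-- **Main Theorem.** For a `k`-tuple of Harish-Chandra characters of level
`H*_{σ,α}`, the multiplicity `⟨Λ ⊗ R(γ_1) ⊗ ⋯ ⊗ R(γ_k), 1⟩` equals the number of
`GL_α(𝔽_q)`-orbits of representations of the star-shaped quiver of dimension `α` over
`𝔽_q` all of whose indecomposable direct summands over `𝔽̄_q` have dimension vector in
`H*_{σ,α}` (non-increasing along the legs, `≤ α`, nonzero and with `σ^{dim} = 1`). -/
theorem statement7 (F : Type) [Field F] [Fintype F] (k m n : ℕ) (hk : 1 ≤ k) (hn : 1 ≤ n)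
    (s : Fin k → ℕ) (nn : Fin k → ℕ → ℕ) (hsum : ∀ i, legβ k s nn i 0 = n)
    (γ : Fin k → ℕ → (Fˣ →* ℂˣ)) :
    mult F k m n s nn γ =
      (orbitCount (starSrc k m s) (starTgt k m s) (K := F) (starα k n s nn)
        (fun x => LevelAtMost (starSrc k m s) (starTgt k m s) x
          {δ | NonIncr k s δ ∧ δ ≠ 0 ∧ (∀ v, δ v ≤ starα k n s nn v) ∧
            ∏ v, (starσ F k s γ v) ^ (δ v) = 1}) : ℂ) := by
  classical
  have : Finite (Config F k m n s) := inferInstanceAs (Finite (_ × _))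
  let _ : Fintype (Config F k m n s) := Fintype.ofFinite _
  rw [mult_eq_sum hsum γ]
  simp only [levelAtMost_iff]
  let _ : Fintype (Config F k m (starα k n s nn none) s) := Fintype.ofFinite (Config F k m n s)
  have key := sum_theta_eq (m := m) (α := starα k n s nn) (starσ F k s γ)
  rw [inv_mul_eq_iff_eq_mul₀ (Nat.cast_ne_zero.2 Fintype.card_ne_zero), mul_comm]
  exact key
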